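/- arXiv:2605.05022 — 2 statements merged into one kernel-verified Lean document; each statement's English description precedes it below -/
import Mathlib

section
/- There exist constants δ > 0 and R₀ > 0 such that for every R ≥ R₀: the first exit time t₁(R) is finite, the exit occurs through the r-axis, i.e. x_R(t₁(R)) = 0 with θ_R(t₁(R)) ∈ (−π, 0), and moreover r_R(t₁(R)) ≥ δ. -/
/-- The arc-length system (1.5): `x' = cos θ`, `r' = sin θ`,
`θ' = ((n-1)/r - (r/2) f'(x²+r²)) cos θ + (x/2) f'(x²+r²) sin θ` on the set `s`. -/
def SolvesSystem (n : ℕ) (f : ℝ → ℝ) (x r θ : ℝ → ℝ) (s : Set ℝ) : Prop :=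
  ∀ t ∈ s,
    HasDerivAt x (Real.cos (θ t)) t ∧
    HasDerivAt r (Real.sin (θ t)) t ∧
    HasDerivAt θ
      ((((n : ℝ) - 1) / r t - r t / 2 * deriv f (x t ^ 2 + r t ^ 2)) * Real.cos (θ t)
        + x t / 2 * deriv f (x t ^ 2 + r t ^ 2) * Real.sin (θ t)) t

/-- None of the exit events `θ = 0`, `θ = -π`, `x = 0`, `r = 0` occurs on `s`. -/
def NoExit (x r θ : ℝ → ℝ) (s : Set ℝ) : Prop :=
  ∀ t ∈ s, θ t ≠ 0 ∧ θ t ≠ -Real.pi ∧ x t ≠ 0 ∧ r t ≠ 0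

namespace ShrinkerArc

open Set Filter Topology

/-- A bounded locally Lipschitz autonomous field on a proper space has solutions on arbitrarily
long time intervals. -/
lemma exists_solution_of_locallyLipschitz_of_bounded {E : Type*} [NormedAddCommGroup E]
    [NormedSpace ℝ E] [ProperSpace E] {G : E → E} (hG : LocallyLipschitz G) {C : ℝ}
    (hC : ∀ p, ‖G p‖ ≤ C) (p₀ : E) {T : ℝ} (hT : 0 < T) :
    ∃ α : ℝ → E, α 0 = p₀ ∧ ∀ t ∈ Icc 0 T, HasDerivAt α (G (α t)) t := by
  have hC0 : 0 ≤ C := (norm_nonneg _).trans (hC p₀)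
  obtain ⟨K, hK⟩ := (hG.locallyLipschitzOn
    (s := Metric.closedBall p₀ (C * (T + 1)))).exists_lipschitzOnWith_of_compact
    (isCompact_closedBall _ _)
  have hmem : (0 : ℝ) ∈ Icc (-1) (T + 1) := ⟨by norm_num, by linarith⟩
  have hPL : IsPicardLindelof (fun _ => G) (tmin := -1) (tmax := T + 1) ⟨0, hmem⟩ p₀
      ⟨C * (T + 1), by positivity⟩ 0 ⟨C, hC0⟩ K :=
    { lipschitzOnWith := fun _ _ => hK
      continuousOn := fun _ _ => continuousOn_const
      norm_le := fun _ _ p _ => hC p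
      mul_max_le := by
        have : max (T + 1) 1 = T + 1 := max_eq_left (by linarith)
        simp only [sub_zero, zero_sub, neg_neg, this, NNReal.coe_zero]
        exact le_rfl }
  obtain ⟨α, h0, hα⟩ := hPL.exists_eq_forall_mem_Icc_hasDerivWithinAt₀
  exact ⟨α, h0, fun t ht => (hα t ⟨by linarith [ht.1], by linarith [ht.2]⟩).hasDerivAt
    (Icc_mem_nhds (by linarith [ht.1]) (by linarith [ht.2]))⟩

/-- A function with derivative of absolute value at most one moves by at most `t` in time `t`. -/
lemma abs_sub_le_of_abs_deriv_le_one {g g' : ℝ → ℝ} {T : ℝ}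
    (hg : ∀ t ∈ Icc 0 T, HasDerivAt g (g' t) t) (hb : ∀ t, |g' t| ≤ 1) {t : ℝ}
    (ht : t ∈ Icc 0 T) : |g t - g 0| ≤ t := by
  have := (convex_Icc 0 T).norm_image_sub_le_of_norm_hasDerivWithin_le (f := g) (f' := g') (C := 1)
    (fun u hu => (hg u hu).hasDerivWithinAt) (fun u _ => hb u)
    (⟨le_rfl, ht.1.trans ht.2⟩ : (0 : ℝ) ∈ Icc 0 T) ht
  simpa [Real.norm_eq_abs, abs_of_nonneg ht.1] using this

/-- Long-time solutions of the arc-length system with the field frozen below `r = δ`. -/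
lemma exists_arclength_solution (n : ℕ) {m M : ℝ} (hm : 0 < m)
    {f : ℝ → ℝ} (hf : ContDiff ℝ 2 f)
    (hlow : ∀ s : ℝ, m ≤ deriv f s) (hup : ∀ s : ℝ, deriv f s ≤ M)
    {δ R T : ℝ} (hδ : 0 < δ) (hR : δ ≤ R) (hT : 0 < T) :
    ∃ x r θ : ℝ → ℝ, x 0 = 0 ∧ r 0 = R ∧ θ 0 = 0 ∧ ∀ t ∈ Icc 0 T,
      HasDerivAt x (Real.cos (θ t)) t ∧ HasDerivAt r (Real.sin (θ t)) t ∧ ContinuousAt θ t ∧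
      (δ ≤ r t → HasDerivAt θ
        ((((n : ℝ) - 1) / r t - r t / 2 * deriv f (x t ^ 2 + r t ^ 2)) * Real.cos (θ t)
          + x t / 2 * deriv f (x t ^ 2 + r t ^ 2) * Real.sin (θ t)) t) := by
  set V : ℝ × ℝ × ℝ → ℝ × ℝ × ℝ := fun p => (Real.cos p.2.2, Real.sin p.2.2,
    (((n : ℝ) - 1) / p.2.1 - p.2.1 / 2 * deriv f (p.1 ^ 2 + p.2.1 ^ 2)) * Real.cos p.2.2
      + p.1 / 2 * deriv f (p.1 ^ 2 + p.2.1 ^ 2) * Real.sin p.2.2) with hV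
  set c : ℝ × ℝ × ℝ → ℝ × ℝ × ℝ :=
    fun p => (max (-T) (min T p.1), max δ (min (R + T) p.2.1), p.2.2) with hc
  have hf' : ContDiff ℝ 1 (deriv f) := by
    have : ContDiff ℝ (1 + 1) f := by simpa [one_add_one_eq_two] using hf
    exact (contDiff_succ_iff_deriv.1 this).2.2
  have hVc : ∀ p : ℝ × ℝ × ℝ, p.2.1 ≠ 0 → ContDiffAt ℝ 1 V p := by
    intro p hp
    have h1 : ContDiffAt ℝ 1 (fun p : ℝ × ℝ × ℝ => deriv f (p.1 ^ 2 + p.2.1 ^ 2)) p :=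
      hf'.contDiffAt.comp p (by fun_prop)
    have h2 : ContDiffAt ℝ 1 (fun p : ℝ × ℝ × ℝ => ((n : ℝ) - 1) / p.2.1) p :=
      contDiffAt_const.div (by fun_prop) hp
    have h3 : ContDiffAt ℝ 1 (fun p : ℝ × ℝ × ℝ => Real.cos p.2.2) p := by fun_prop
    have h4 : ContDiffAt ℝ 1 (fun p : ℝ × ℝ × ℝ => Real.sin p.2.2) p := by fun_prop
    have h5 : ContDiffAt ℝ 1 (fun p : ℝ × ℝ × ℝ => p.2.1 / 2) p := by fun_prop
    have h6 : ContDiffAt ℝ 1 (fun p : ℝ × ℝ × ℝ => p.1 / 2) p := by fun_prop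
    exact h3.prodMk (h4.prodMk (((h2.sub (h5.mul h1)).mul h3).add ((h6.mul h1).mul h4)))
  have hcl : LipschitzWith 1 c := by
    have h1 : LipschitzWith 1 (fun p : ℝ × ℝ × ℝ => max (-T) (min T p.1)) :=
      (LipschitzWith.prod_fst.const_min T).const_max (-T)
    have h2 : LipschitzWith 1 (fun p : ℝ × ℝ × ℝ => p.2) := LipschitzWith.prod_snd
    have h3 : LipschitzWith 1 (fun p : ℝ × ℝ × ℝ => p.2.1) := by
      simpa using! LipschitzWith.prod_fst.comp h2
    have h4 : LipschitzWith 1 (fun p : ℝ × ℝ × ℝ => p.2.2) := by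
      simpa using! LipschitzWith.prod_snd.comp h2
    simpa using h1.prodMk (((h3.const_min (R + T)).const_max δ).prodMk h4)
  have hG : LocallyLipschitz (V ∘ c) := by
    intro p
    have hp : (c p).2.1 ≠ 0 := (hδ.trans_le (le_max_left _ _)).ne'
    obtain ⟨K, t, ht, hK⟩ := (hVc _ hp).exists_lipschitzOnWith
    refine ⟨K * 1, c ⁻¹' t, hcl.continuous.continuousAt ht, ?_⟩
    exact hK.comp (hcl.lipschitzOnWith) (mapsTo_preimage c t)
  have hM : 0 < M := hm.trans_le ((hlow 0).trans (hup 0))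
  have hbd : ∀ p, ‖(V ∘ c) p‖ ≤ 1 + ((|(n : ℝ) - 1| / δ + (R + T) / 2 * M) + T / 2 * M) := by
    intro p
    have hcx : |(c p).1| ≤ T := abs_le.2 ⟨le_max_left _ _, max_le (by linarith) (min_le_left _ _)⟩
    have hr1 : δ ≤ (c p).2.1 := le_max_left _ _
    have hr2 : (c p).2.1 ≤ R + T := max_le (by linarith) (min_le_left _ _)
    rw [Function.comp_apply]
    generalize c p = q at *
    have hr0 : 0 < q.2.1 := hδ.trans_le hr1
    have hd : |deriv f (q.1 ^ 2 + q.2.1 ^ 2)| ≤ M :=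
      abs_le.2 ⟨by linarith [hlow (q.1 ^ 2 + q.2.1 ^ 2)], hup _⟩
    have hcos := Real.abs_cos_le_one q.2.2
    have hsin := Real.abs_sin_le_one q.2.2
    have hRT' : 0 ≤ (R + T) / 2 := by linarith
    have hRT : 0 ≤ (R + T) / 2 * M := by positivity
    have hk : 0 ≤ |(n : ℝ) - 1| / δ := by positivity
    have hTM : 0 ≤ T / 2 * M := by positivity
    have key : |(((n : ℝ) - 1) / q.2.1 - q.2.1 / 2 * deriv f (q.1 ^ 2 + q.2.1 ^ 2)) *
        Real.cos q.2.2 + q.1 / 2 * deriv f (q.1 ^ 2 + q.2.1 ^ 2) * Real.sin q.2.2| ≤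
        (|(n : ℝ) - 1| / δ + (R + T) / 2 * M) + T / 2 * M := by
      have e1 : |((n : ℝ) - 1) / q.2.1| ≤ |(n : ℝ) - 1| / δ := by
        rw [abs_div, abs_of_pos hr0]; gcongr
      have e2 : |q.2.1 / 2 * deriv f (q.1 ^ 2 + q.2.1 ^ 2)| ≤ (R + T) / 2 * M := by
        rw [abs_mul, abs_of_pos (by positivity : 0 < q.2.1 / 2)]; gcongr
      have e3 : |q.1 / 2 * deriv f (q.1 ^ 2 + q.2.1 ^ 2)| ≤ T / 2 * M := by
        rw [abs_mul, abs_div, abs_two]; gcongr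
      refine (abs_add_le _ _).trans (add_le_add ?_ ?_)
      · rw [abs_mul]
        exact (mul_le_of_le_one_right (abs_nonneg _) hcos).trans
          ((abs_sub _ _).trans (add_le_add e1 e2))
      · rw [abs_mul]
        exact (mul_le_of_le_one_right (abs_nonneg _) hsin).trans e3
    simp only [hV, Prod.norm_def, Real.norm_eq_abs, max_le_iff]
    exact ⟨by linarith, by linarith, by linarith⟩
  obtain ⟨α, h0, hα⟩ := exists_solution_of_locallyLipschitz_of_bounded hG hbd
    ((0, R, 0) : ℝ × ℝ × ℝ) hT
  have hx : ∀ t ∈ Icc 0 T, HasDerivAt (fun t => (α t).1) (Real.cos (α t).2.2) t :=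
    fun t ht => (hα t ht).fst
  have hr : ∀ t ∈ Icc 0 T, HasDerivAt (fun t => (α t).2.1) (Real.sin (α t).2.2) t :=
    fun t ht => (hα t ht).snd.fst
  have hθ : ∀ t ∈ Icc 0 T, HasDerivAt (fun t => (α t).2.2) ((V ∘ c) (α t)).2.2 t :=
    fun t ht => (hα t ht).snd.snd
  refine ⟨fun t => (α t).1, fun t => (α t).2.1, fun t => (α t).2.2, by simp [h0], by simp [h0],
    by simp [h0], fun t ht => ⟨hx t ht, hr t ht, (hθ t ht).continuousAt, fun hδr => ?_⟩⟩
  have hxt := abs_sub_le_of_abs_deriv_le_one hx (fun _ => Real.abs_cos_le_one _) ht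
  have hrt := abs_sub_le_of_abs_deriv_le_one hr (fun _ => Real.abs_sin_le_one _) ht
  simp only [h0, sub_zero, abs_le] at hxt hrt
  have h1 : max (-T) (min T (α t).1) = (α t).1 := by
    rw [min_eq_right (by linarith [ht.2]), max_eq_right (by linarith [ht.2])]
  have h2 : max δ (min (R + T) (α t).2.1) = (α t).2.1 := by
    rw [min_eq_right (by linarith [ht.2]), max_eq_right hδr]
  have h3 := hθ t ht
  simpa only [Function.comp, hV, hc, h1, h2] using h3

/-- If `g ≤ 0` at the left endpoint and `g' < 0` wherever `g = 0`, then `g ≤ 0`. -/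
lemma nonpos_of_deriv_neg_of_eq_zero {g g' : ℝ → ℝ} {a b : ℝ}
    (hc : ContinuousOn g (Icc a b)) (hg : ∀ t ∈ Ico a b, HasDerivAt g (g' t) t) (ha : g a ≤ 0)
    (h : ∀ t ∈ Ico a b, g t = 0 → g' t < 0) {t : ℝ} (ht : t ∈ Icc a b) : g t ≤ 0 :=
  image_le_of_deriv_right_lt_deriv_boundary (B := fun _ => 0) (B' := fun _ => 0) hc
    (fun u hu => (hg u hu).hasDerivWithinAt) ha (fun u => hasDerivAt_const u 0) h ht

/-- Strict version of `nonpos_of_deriv_neg_of_eq_zero`. -/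
lemma neg_of_deriv_neg_of_eq_zero {g g' : ℝ → ℝ} {a b : ℝ}
    (hg : ∀ t ∈ Icc a b, HasDerivAt g (g' t) t) (ha : g a ≤ 0)
    (h : ∀ t ∈ Icc a b, g t = 0 → g' t < 0) {t : ℝ} (ht : t ∈ Ioc a b) : g t < 0 := by
  have hle : ∀ u ∈ Icc a b, g u ≤ 0 := fun u hu =>
    nonpos_of_deriv_neg_of_eq_zero (fun v hv => (hg v hv).continuousAt.continuousWithinAt)
      (fun v hv => hg v ⟨hv.1, hv.2.le⟩) ha (fun v hv => h v ⟨hv.1, hv.2.le⟩) hu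
  have htI : t ∈ Icc a b := ⟨ht.1.le, ht.2⟩
  refine (hle t htI).lt_of_ne fun h0 => ?_
  have hd := h t htI h0
  have hs := ((hasDerivAt_iff_tendsto_slope_left_right.1 (hg t htI)).1).eventually
    (eventually_lt_nhds hd)
  obtain ⟨u, hu, hua⟩ := (hs.and (Ioo_mem_nhdsLT ht.1)).exists
  rw [slope_def_field, h0, sub_zero] at hu
  exact hu.not_ge (div_nonneg_of_nonpos (hle u ⟨hua.1.le, hua.2.le.trans ht.2⟩)
    (by linarith [hua.2]))


/-- The arc-length system with dimension constant `k` and coefficient `a t` in place of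
`f' (x² + r²)`. -/
def SolvesArcSystem (k : ℝ) (a x r θ : ℝ → ℝ) (s : Set ℝ) : Prop :=
  ∀ t ∈ s,
    HasDerivAt x (Real.cos (θ t)) t ∧
    HasDerivAt r (Real.sin (θ t)) t ∧
    HasDerivAt θ ((k / r t - r t / 2 * a t) * Real.cos (θ t)
        + x t / 2 * a t * Real.sin (θ t)) t

namespace SolvesArcSystem

variable {k : ℝ} {a x r θ : ℝ → ℝ} {s : Set ℝ}

lemma mono (h : SolvesArcSystem k a x r θ s) {s' : Set ℝ} (hs : s' ⊆ s) :
    SolvesArcSystem k a x r θ s' := fun t ht => h t (hs ht)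

/-- Derivative of the support-type function `x sin θ - φ(r) cos θ`. -/
lemma hasDerivAt_sub_comp_mul_cos (h : SolvesArcSystem k a x r θ s) {φ : ℝ → ℝ} {φ' : ℝ} {t : ℝ}
    (ht : t ∈ s) (hφ : HasDerivAt φ φ' (r t)) :
    HasDerivAt (fun t => x t * Real.sin (θ t) - φ (r t) * Real.cos (θ t))
      (Real.cos (θ t) * Real.sin (θ t) * (1 - φ') +
        (x t * Real.cos (θ t) + φ (r t) * Real.sin (θ t)) *
        ((k / r t - r t / 2 * a t) * Real.cos (θ t) + x t / 2 * a t * Real.sin (θ t))) t := by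
  obtain ⟨h1, h2, h3⟩ := h t ht
  refine ((h1.mul h3.sin).sub ((hφ.comp t h2).mul h3.cos)).congr_deriv ?_
  simp only [Function.comp]
  ring

/-- Derivative of the support-type function `x sin θ - r cos θ`. -/
lemma hasDerivAt_support (h : SolvesArcSystem k a x r θ s) {t : ℝ} (ht : t ∈ s) :
    HasDerivAt (fun t => x t * Real.sin (θ t) - r t * Real.cos (θ t))
      ((x t * Real.cos (θ t) + r t * Real.sin (θ t)) *
        ((k / r t - r t / 2 * a t) * Real.cos (θ t) + x t / 2 * a t * Real.sin (θ t))) t :=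
  (h.hasDerivAt_sub_comp_mul_cos ht (hasDerivAt_id (r t))).congr_deriv (by simp)

lemma hasDerivAt_div (h : SolvesArcSystem k a x r θ s) {t : ℝ} (ht : t ∈ s) (hr : r t ≠ 0) :
    HasDerivAt (fun t => x t / r t)
      (-(x t * Real.sin (θ t) - r t * Real.cos (θ t)) / r t ^ 2) t :=
  ((h t ht).1.div (h t ht).2.1 hr).congr_deriv (by ring)

end SolvesArcSystem

/-- Sign of the derivative of `x sin θ - r cos θ` at its zeros. -/
lemma support_deriv_pos {k a x r c s : ℝ} (hk : 0 < k) (hx : 0 < x) (hr : 0 < r) (hs : s < 0)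
    (h0 : x * s - r * c = 0) :
    0 < (x * c + r * s) * ((k / r - r / 2 * a) * c + x / 2 * a * s) := by
  have hc : c = x * s / r := by field_simp; linarith
  have hc0 : c < 0 := by rw [hc]; exact div_neg_of_neg_of_pos (mul_neg_of_pos_of_neg hx hs) hr
  have e : (k / r - r / 2 * a) * c + x / 2 * a * s = k / r * c := by
    linear_combination (a / 2) * h0
  rw [e]
  refine mul_pos_of_neg_of_neg ?_ (mul_neg_of_pos_of_neg (by positivity) hc0)
  have := mul_neg_of_pos_of_neg hx hc0
  have := mul_neg_of_pos_of_neg hr hs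
  linarith

/-- Sign of the derivative of `x sin θ - r cos θ + σ (1 + exp (L (ρ - r))) sin θ` at its zeros;
`e` stands for the exponential. -/
lemma slope_barrier_deriv_neg {k m a x r c s σ ρ L e δ : ℝ} (hk : 0 < k) (hm : 0 < m)
    (hma : m ≤ a) (hδ : 0 < δ) (hδr : δ ≤ r) (hx : 0 < x) (hs : s < 0) (hσ : 0 < σ)
    (hxr : x ≤ σ * r) (hρ1 : 1 ≤ ρ) (hρ : 8 * k ≤ m * ρ) (he : 0 < e) (he1 : r ≤ ρ → 1 ≤ e)
    (hsmall1 : r ≤ ρ → x + σ * (1 + e) ≤ 1) (hsmall2 : r ≤ ρ → x + σ * (1 + e) ≤ δ)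
    (hL : (1 + ρ) * (k * (ρ + 2) / δ ^ 2) < L)
    (h0 : x * s - r * c + σ * (1 + e) * s = 0) :
    (x * c + r * s) * ((k / r - r / 2 * a) * c + x / 2 * a * s) +
      (-(σ * L * e * s) * s +
        σ * (1 + e) * (c * ((k / r - r / 2 * a) * c + x / 2 * a * s))) < 0 := by
  have hr : 0 < r := hδ.trans_le hδr
  set lam := σ * (1 + e) with hlam
  have hlam0 : 0 < lam := by positivity
  have hc : c = (x + lam) * s / r := by field_simp; linarith
  have eθ : (k / r - r / 2 * a) * c + x / 2 * a * s =
      s * (k * (x + lam) / r ^ 2 - a * lam / 2) := by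
    rw [hc]; field_simp; ring
  have eQ : x * c + r * s + lam * c = s * ((x + lam) ^ 2 / r + r) := by
    rw [hc]; field_simp; ring
  rw [eθ]
  have e2 : (x * c + r * s) * (s * (k * (x + lam) / r ^ 2 - a * lam / 2)) +
      (-(σ * L * e * s) * s + lam * (c * (s * (k * (x + lam) / r ^ 2 - a * lam / 2)))) =
      s ^ 2 * (((x + lam) ^ 2 / r + r) * (k * (x + lam) / r ^ 2 - a * lam / 2) - σ * L * e) := by
    linear_combination (s * (k * (x + lam) / r ^ 2 - a * lam / 2)) * eQ
  rw [e2]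
  have hL0 : 0 < L := lt_of_le_of_lt (by positivity) hL
  have hs0 := hs.ne
  refine mul_neg_of_pos_of_neg (by positivity) ?_
  have hA : 0 < (x + lam) ^ 2 / r + r := by positivity
  have hσLe : 0 < σ * L * e := by positivity
  rcases le_total ρ r with hrρ | hrρ
  · have hkr : k / r ≤ m / 8 := by
      rw [div_le_div_iff₀ hr (by norm_num)]
      nlinarith
    have hkr2 : k / r ^ 2 ≤ m / 8 := by
      refine le_trans ?_ hkr
      exact div_le_div_of_nonneg_left hk.le hr (by nlinarith)
    have h1 : k * (x + lam) / r ^ 2 ≤ m / 4 * lam := by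
      have h2 : k * x / r ^ 2 ≤ m / 8 * σ := by
        calc k * x / r ^ 2 ≤ k * (σ * r) / r ^ 2 := by gcongr
          _ = k / r * σ := by field_simp
          _ ≤ m / 8 * σ := by gcongr
      have h3 : k * lam / r ^ 2 ≤ m / 8 * lam := by
        calc k * lam / r ^ 2 = k / r ^ 2 * lam := by ring
          _ ≤ _ := by gcongr
      have h4 : σ ≤ lam := by rw [hlam]; nlinarith
      have h5 : m / 8 * σ ≤ m / 8 * lam := by gcongr
      rw [mul_add, add_div]
      linarith
    have h6 : m * lam ≤ a * lam := by gcongr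
    have h7 : 0 < m * lam := by positivity
    have : ((x + lam) ^ 2 / r + r) * (k * (x + lam) / r ^ 2 - a * lam / 2) < 0 :=
      mul_neg_of_pos_of_neg hA (by linarith)
    linarith
  · have he1' := he1 hrρ
    have hA' : (x + lam) ^ 2 / r + r ≤ 1 + ρ := by
      have : (x + lam) ^ 2 / r ≤ 1 := by
        rw [div_le_one hr]
        calc (x + lam) ^ 2 = (x + lam) * (x + lam) := sq _
          _ ≤ 1 * δ := mul_le_mul (hsmall1 hrρ) (hsmall2 hrρ) (by positivity) zero_le_one
          _ ≤ r := by linarith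
      linarith
    have hB : k * (x + lam) / r ^ 2 - a * lam / 2 ≤ k * (ρ + 2) / δ ^ 2 * (σ * e) := by
      have h1 : x + lam ≤ (ρ + 2) * (σ * e) := by
        have : x ≤ σ * e * ρ := by
          calc x ≤ σ * r := hxr
            _ ≤ σ * ρ := by gcongr
            _ ≤ σ * e * ρ := by
              have : σ * 1 ≤ σ * e := by gcongr
              have : 0 ≤ ρ := by linarith
              gcongr
              linarith
        have : lam ≤ 2 * (σ * e) := by
          have : σ * 1 ≤ σ * e := by gcongr
          rw [hlam, mul_add]
          linarith
        linarith
      have h2 : k * (x + lam) / r ^ 2 ≤ k * ((ρ + 2) * (σ * e)) / δ ^ 2 := by gcongr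
      have h3 : 0 ≤ a * lam := by have := hm.trans_le hma; positivity
      have h4 : k * ((ρ + 2) * (σ * e)) / δ ^ 2 = k * (ρ + 2) / δ ^ 2 * (σ * e) := by ring
      linarith
    have hσe : 0 < σ * e := by positivity
    have h1 : ((x + lam) ^ 2 / r + r) * (k * (x + lam) / r ^ 2 - a * lam / 2) ≤
        (1 + ρ) * (k * (ρ + 2) / δ ^ 2 * (σ * e)) := by
      calc _ ≤ ((x + lam) ^ 2 / r + r) * (k * (ρ + 2) / δ ^ 2 * (σ * e)) := by gcongr
        _ ≤ _ := by gcongr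
    have h2 := mul_lt_mul_of_pos_right hL hσe
    linarith

/-- Sign of the derivative of `x sin θ - φ(r) cos θ` at its zeros, where
`φ(r) = (r - δ) + (r - δ)² / (80 δ)`. -/
lemma crossing_barrier_deriv_pos {k M a x r c s δ φ : ℝ} (hk : 1 ≤ k) (ha : 0 < a) (haM : a ≤ M)
    (hδ : 0 < δ) (hMδ : 100 * M * δ ^ 2 ≤ 1) (hδr : δ ≤ r) (hx : 0 < x) (hs : s < 0)
    (hs1 : s ^ 2 + c ^ 2 = 1) (hP : 0 ≤ x * s - r * c)
    (hφ : φ = (r - δ) + (r - δ) ^ 2 / (80 * δ)) (h0 : x * s - φ * c = 0) :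
    0 < c * s * (1 - (1 + (r - δ) / (40 * δ))) +
      (x * c + φ * s) * ((k / r - r / 2 * a) * c + x / 2 * a * s) := by
  have hr : 0 < r := hδ.trans_le hδr
  have hs0 : s ≠ 0 := hs.ne
  have hxs : x * s < 0 := mul_neg_of_pos_of_neg hx hs
  have hc : c < 0 := by
    by_contra h
    have := mul_nonneg hr.le (not_lt.1 h)
    linarith
  have hφ0 : 0 < φ := by
    by_contra h
    have := mul_nonneg_of_nonpos_of_nonpos (not_lt.1 h) hc.le
    linarith
  have hφr : φ ≤ r := by
    by_contra h
    have : (φ - r) * c < 0 := mul_neg_of_pos_of_neg (by linarith) hc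
    linarith
  have hrδ : δ < r := by
    rcases hδr.lt_or_eq with h | h
    · exact h
    · rw [hφ, ← h] at hφ0; simp at hφ0
  have hr10 : r ≤ 10 * δ := by
    by_contra h
    push Not at h
    have h9 : 9 * δ ≤ r - δ := by linarith
    have : δ ≤ (r - δ) ^ 2 / (80 * δ) := by
      rw [le_div_iff₀ (by positivity)]
      nlinarith
    have : (r - δ) ^ 2 / (80 * δ) > δ := by
      rw [gt_iff_lt, lt_div_iff₀ (by positivity)]
      nlinarith
    linarith
  have hxφ : x = φ * c / s := by rw [eq_div_iff hs.ne]; linarith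
  have e : c * s * (1 - (1 + (r - δ) / (40 * δ))) +
      (x * c + φ * s) * ((k / r - r / 2 * a) * c + x / 2 * a * s) =
      c / s * (φ * (k / r - a / 2 * (r - φ)) - s ^ 2 * ((r - δ) / (40 * δ))) := by
    have e1 : x * c + φ * s = φ / s := by
      rw [hxφ]; field_simp; linear_combination hs1
    have e2 : (k / r - r / 2 * a) * c + x / 2 * a * s = c * (k / r - a / 2 * (r - φ)) := by
      linear_combination (a / 2) * h0
    rw [e1, e2]
    field_simp
    ring
  rw [e]
  refine mul_pos (div_pos_of_neg_of_neg hc hs) ?_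
  have h1 : 1 / (2 * r) ≤ k / r - a / 2 * (r - φ) := by
    have h2 : a / 2 * (r - φ) ≤ M / 2 * r := by
      have : r - φ ≤ r := by linarith
      have : 0 ≤ r - φ := by linarith
      have : 0 ≤ M := ha.le.trans haM
      gcongr
    have h3 : M / 2 * r ≤ 1 / (2 * r) := by
      rw [le_div_iff₀ (by positivity)]
      have hM : 0 < M := ha.trans_le haM
      have : M * r ^ 2 ≤ M * (10 * δ) ^ 2 := by gcongr
      nlinarith
    have h4 : 1 / r ≤ k / r := by gcongr
    have h5 : 1 / r = 1 / (2 * r) + 1 / (2 * r) := by field_simp; norm_num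
    linarith
  have h2 : (r - δ) / (40 * δ) < φ * (1 / (2 * r)) := by
    have h3 : φ = (r - δ) * (79 * δ + r) / (80 * δ) := by rw [hφ]; field_simp; ring
    rw [h3, div_mul_div_comm, div_lt_div_iff₀ (by positivity) (by positivity)]
    have : 0 < r - δ := by linarith
    have h4 : 0 < (r - δ) * δ * (79 * δ - 3 * r) := by
      have : 0 < 79 * δ - 3 * r := by linarith
      positivity
    nlinarith
  have h3 : φ * (1 / (2 * r)) ≤ φ * (k / r - a / 2 * (r - φ)) := by gcongr
  have h4 : s ^ 2 * ((r - δ) / (40 * δ)) ≤ 1 * ((r - δ) / (40 * δ)) := by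
    have : 0 ≤ (r - δ) / (40 * δ) := div_nonneg (by linarith) (by positivity)
    gcongr
    nlinarith [sq_nonneg c]
  linarith

lemma nonneg_of_nonneg_Ico {g : ℝ → ℝ} {a b : ℝ} (hab : a < b) (hg : ContinuousAt g b)
    (h : ∀ t ∈ Ico a b, 0 ≤ g t) : 0 ≤ g b :=
  ge_of_tendsto (hg.mono_left nhdsWithin_le_nhds : Tendsto g (𝓝[<] b) (𝓝 (g b)))
    (by filter_upwards [Ico_mem_nhdsLT hab] using h)

/-- Along a descending arc which starts radially (`x sin θ = r cos θ`) and close to the `r`-axis,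
the tangent stays within `π / 4` of the vertical, and the arc cannot reach `r = δ` with `x > 0`. -/
lemma exists_descent_bounds {k m M δ : ℝ} (hk : 1 ≤ k) (hm : 0 < m) (hδ : 0 < δ)
    (hMδ : 100 * M * δ ^ 2 ≤ 1) :
    ∃ σ > 0, ∀ (a x r θ : ℝ → ℝ) (t₀ t₁ : ℝ), t₀ < t₁ →
      SolvesArcSystem k a x r θ (Icc t₀ t₁) → (∀ t, m ≤ a t) → (∀ t, a t ≤ M) →
      (∀ t ∈ Icc t₀ t₁, δ ≤ r t) → (∀ t ∈ Ico t₀ t₁, 0 < x t ∧ Real.sin (θ t) < 0) →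
      x t₀ * Real.sin (θ t₀) = r t₀ * Real.cos (θ t₀) → x t₀ ≤ σ * r t₀ → 10 * δ ≤ r t₀ →
      (Real.sin (θ t₁) ≤ Real.cos (θ t₁) ∧ Real.cos (θ t₁) ≤ 0) ∧
      (r t₁ = δ → 0 ≤ x t₁ * Real.sin (θ t₁)) := by
  have hk0 : 0 < k := by linarith
  set ρ := max 1 (8 * k / m) with hρdef
  have hρ1 : 1 ≤ ρ := le_max_left _ _
  have hρ : 8 * k ≤ m * ρ := by
    have : 8 * k / m ≤ ρ := le_max_right _ _
    rw [div_le_iff₀ hm] at this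
    linarith
  set L := (1 + ρ) * (k * (ρ + 2) / δ ^ 2) + 1 with hLdef
  have hL : 0 < L := by positivity
  set E := Real.exp (L * ρ) with hE
  have hE0 : 0 < E := Real.exp_pos _
  set D := ρ + 1 + E + 1 / δ * (ρ + 1 + E) + (1 + E) / δ + 1 with hD
  have hD0 : 0 < D := by positivity
  refine ⟨1 / D, by positivity, ?_⟩
  set σ := 1 / D with hσdef
  have hσ : 0 < σ := by positivity
  have hσD : σ * D = 1 := by rw [hσdef]; field_simp
  have hb1 : σ * (ρ + 1 + E) ≤ 1 := by
    refine le_of_le_of_eq ?_ hσD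
    gcongr
    have : 0 < 1 / δ * (ρ + 1 + E) := by positivity
    have : 0 < (1 + E) / δ := by positivity
    linarith
  have hb2 : σ * (ρ + 1 + E) ≤ δ := by
    have : σ * (1 / δ * (ρ + 1 + E)) ≤ σ * D := by
      gcongr
      have : 0 < (1 + E) / δ := by positivity
      linarith
    rw [hσD] at this
    have := mul_le_mul_of_nonneg_left this hδ.le
    have e : δ * (σ * (1 / δ * (ρ + 1 + E))) = σ * (ρ + 1 + E) := by field_simp
    linarith
  have hb3 : σ * (1 + (1 + E) / δ) ≤ 1 := by
    refine le_of_le_of_eq ?_ hσD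
    gcongr
    have : 0 < 1 / δ * (ρ + 1 + E) := by positivity
    linarith
  intro a x r θ t₀ t₁ h01 hsys hma haM hδr hgood hP0 hx0 hr0
  have hsub : Ico t₀ t₁ ⊆ Icc t₀ t₁ := Ico_subset_Icc_self
  have hrpos : ∀ t ∈ Icc t₀ t₁, 0 < r t := fun t ht => hδ.trans_le (hδr t ht)
  have ht0 : t₀ ∈ Icc t₀ t₁ := ⟨le_rfl, h01.le⟩
  have ht1 : t₁ ∈ Icc t₀ t₁ := ⟨h01.le, le_rfl⟩
  have hP : ∀ t ∈ Icc t₀ t₁, 0 ≤ x t * Real.sin (θ t) - r t * Real.cos (θ t) := by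
    intro t ht
    refine neg_nonpos.1 (nonpos_of_deriv_neg_of_eq_zero
      (fun u hu => (hsys.hasDerivAt_support hu).neg.continuousAt.continuousWithinAt)
      (fun u hu => (hsys.hasDerivAt_support (hsub hu)).neg) ?_ ?_ ht)
    · simp [hP0]
    · intro u hu h0
      exact neg_neg_of_pos (support_deriv_pos hk0 (hgood u hu).1 (hrpos u (hsub hu))
        (hgood u hu).2 (neg_eq_zero.1 h0))
  have hxr : ∀ t ∈ Icc t₀ t₁, x t ≤ σ * r t := by
    intro t ht
    have hanti : AntitoneOn (fun t => x t / r t) (Icc t₀ t₁) := by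
      refine antitoneOn_of_hasDerivWithinAt_nonpos (convex_Icc _ _)
        (fun u hu => (hsys.hasDerivAt_div hu (hrpos u hu).ne').continuousAt.continuousWithinAt)
        (fun u hu => (hsys.hasDerivAt_div (interior_subset hu)
          (hrpos u (interior_subset hu)).ne').hasDerivWithinAt) ?_
      intro u hu
      exact div_nonpos_of_nonpos_of_nonneg (neg_nonpos.2 (hP u (interior_subset hu))) (sq_nonneg _)
    have h1 := hanti ht0 ht ht.1
    have h2 : x t₀ / r t₀ ≤ σ := (div_le_iff₀ (hrpos _ ht0)).2 hx0
    exact (div_le_iff₀ (hrpos t ht)).1 (h1.trans h2)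
  have hsin1 : Real.sin (θ t₁) ≤ 0 ∧ 0 ≤ x t₁ := by
    refine ⟨neg_nonneg.1 (nonneg_of_nonneg_Ico (g := fun t => -Real.sin (θ t)) h01
      (hsys t₁ ht1).2.2.sin.neg.continuousAt fun u hu => neg_nonneg.2 (hgood u hu).2.le),
      nonneg_of_nonneg_Ico h01
      (hsys t₁ ht1).1.continuousAt fun u hu => (hgood u hu).1.le⟩
  have hEle : ∀ u, 0 ≤ r u → Real.exp (L * (ρ - r u)) ≤ E := by
    intro u hu
    refine Real.exp_le_exp.2 ?_
    have := mul_nonneg hL.le hu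
    linarith
  have hslope : x t₁ * Real.sin (θ t₁) - r t₁ * Real.cos (θ t₁) +
      σ * (1 + Real.exp (L * (ρ - r t₁))) * Real.sin (θ t₁) ≤ 0 := by
    have hd : ∀ u ∈ Icc t₀ t₁, HasDerivAt (fun t => x t * Real.sin (θ t) - r t * Real.cos (θ t) +
      σ * (1 + Real.exp (L * (ρ - r t))) * Real.sin (θ t)) _ u := fun u hu =>
      (hsys.hasDerivAt_support hu).add ((((((hsys u hu).2.1.const_sub ρ).const_mul L).exp.const_add
        1).const_mul σ).mul (hsys u hu).2.2.sin)
    refine nonpos_of_deriv_neg_of_eq_zero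
      (fun u hu => (hd u hu).continuousAt.continuousWithinAt) (fun u hu => hd u (hsub hu)) ?_ ?_ ht1
    · have h1 := (hgood t₀ ⟨le_rfl, h01⟩).2
      have : 0 < σ * (1 + Real.exp (L * (ρ - r t₀))) := by positivity
      have := mul_neg_of_pos_of_neg this h1
      linarith
    · intro u hu h0
      have hru := hrpos u (hsub hu)
      have hxs : r u ≤ ρ → x u + σ * (1 + Real.exp (L * (ρ - r u))) ≤ σ * (ρ + 1 + E) := by
        intro hrρ
        have h1 : x u ≤ σ * ρ := (hxr u (hsub hu)).trans (by gcongr)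
        have h2 : σ * (1 + Real.exp (L * (ρ - r u))) ≤ σ * (1 + E) := by
          gcongr
          exact hEle u hru.le
        linarith
      have := slope_barrier_deriv_neg (a := a u) hk0 hm (hma u) hδ (hδr u (hsub hu)) (hgood u hu).1
        (hgood u hu).2 hσ (hxr u (hsub hu)) hρ1 hρ (Real.exp_pos (L * (ρ - r u)))
        (fun h => Real.one_le_exp (mul_nonneg hL.le (by linarith))) (fun h => (hxs h).trans hb1)
        (fun h => (hxs h).trans hb2) (lt_add_one _ : _ < L) h0
      refine lt_of_eq_of_lt ?_ this
      ring
  have hr1 := hrpos t₁ ht1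
  have hP1 := hP t₁ ht1
  have hxs1 := mul_nonpos_of_nonneg_of_nonpos hsin1.2 hsin1.1
  refine ⟨⟨?_, ?_⟩, ?_⟩
  · have hw : x t₁ + σ * (1 + Real.exp (L * (ρ - r t₁))) ≤ r t₁ := by
      calc x t₁ + σ * (1 + Real.exp (L * (ρ - r t₁))) ≤ σ * r t₁ + σ * (1 + E) := by
            gcongr
            · exact hxr t₁ ht1
            · exact hEle t₁ hr1.le
        _ = σ * (r t₁ + (1 + E) / δ * δ) := by field_simp
        _ ≤ σ * (r t₁ + (1 + E) / δ * r t₁) := by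
            gcongr
            exact hδr t₁ ht1
        _ = σ * (1 + (1 + E) / δ) * r t₁ := by ring
        _ ≤ 1 * r t₁ := by gcongr
        _ = r t₁ := one_mul _
    have := mul_le_mul_of_nonpos_right hw hsin1.1
    exact le_of_mul_le_mul_left (by linarith) hr1
  · by_contra h
    have := mul_pos hr1 (not_le.1 h)
    linarith
  · intro hrδ
    set φ : ℝ → ℝ := fun y => (y - δ) + (y - δ) ^ 2 / (80 * δ) with hφ
    have hφd : ∀ y, HasDerivAt φ (1 + (y - δ) / (40 * δ)) y := by
      intro y
      refine (((hasDerivAt_id y).sub_const δ).add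
        ((((hasDerivAt_id y).sub_const δ).pow 2).div_const (80 * δ))).congr_deriv ?_
      simp only [id]
      field_simp
      norm_num
      ring
    have hd := fun u hu => (hsys.hasDerivAt_sub_comp_mul_cos (t := u) hu (hφd (r u))).neg
    have := nonpos_of_deriv_neg_of_eq_zero
      (fun u hu => (hd u hu).continuousAt.continuousWithinAt) (fun u hu => hd u (hsub hu)) ?_ ?_ ht1
    · have h2 : φ (r t₁) = 0 := by simp [hφ, hrδ]
      simpa [h2] using this
    · have h1 : r t₀ ≤ φ (r t₀) := by
        have : δ ≤ (r t₀ - δ) ^ 2 / (80 * δ) := by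
          rw [le_div_iff₀ (by positivity)]
          nlinarith
        simp only [hφ]
        linarith
      have h2 : Real.cos (θ t₀) ≤ 0 := by
        by_contra h
        have := mul_pos (hrpos t₀ ht0) (not_le.1 h)
        have := mul_neg_of_pos_of_neg (hgood t₀ ⟨le_rfl, h01⟩).1 (hgood t₀ ⟨le_rfl, h01⟩).2
        linarith
      have := mul_le_mul_of_nonpos_right h1 h2
      simp only [Pi.neg_apply]
      linarith
    · intro u hu h0
      exact neg_neg_of_pos (crossing_barrier_deriv_pos hk (hm.trans_le (hma u)) (haM u) hδ hMδ
        (hδr u (hsub hu)) (hgood u hu).1 (hgood u hu).2 (Real.sin_sq_add_cos_sq _)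
        (hP u (hsub hu)) rfl (neg_eq_zero.1 h0))

lemma antitoneOn_Icc_of_hasDerivAt_nonpos {g g' : ℝ → ℝ} {a b : ℝ}
    (hg : ∀ t ∈ Icc a b, HasDerivAt g (g' t) t) (h : ∀ t ∈ Icc a b, g' t ≤ 0) :
    AntitoneOn g (Icc a b) :=
  antitoneOn_of_hasDerivWithinAt_nonpos (convex_Icc _ _)
    (fun u hu => (hg u hu).continuousAt.continuousWithinAt)
    (fun u hu => (hg u (interior_subset hu)).hasDerivWithinAt)
    (fun u hu => h u (interior_subset hu))

/-- As long as `r cos θ - x sin θ` stays positive, an arc starting horizontally on the `r`-axis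
stays in the region `x > 0`, `-π < θ < 0`. -/
lemma pos_and_angle_mem_of_support_pos {k b : ℝ} {a x r θ : ℝ → ℝ} (hb : 0 < b)
    (h : SolvesArcSystem k a x r θ (Icc 0 b)) (hr : ∀ t ∈ Icc 0 b, 0 < r t)
    (hneg : ∀ t ∈ Icc 0 b, k / r t - r t / 2 * a t < 0) (hx0 : x 0 = 0) (hθ0 : θ 0 = 0)
    (hp : ∀ t ∈ Ico 0 b, 0 < r t * Real.cos (θ t) - x t * Real.sin (θ t)) {t : ℝ}
    (ht : t ∈ Ioc 0 b) : 0 < x t ∧ -Real.pi < θ t ∧ θ t < 0 := by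
  have hpd : ∀ u ∈ Icc 0 b,
      ContinuousAt (fun t => r t * Real.cos (θ t) - x t * Real.sin (θ t)) u := fun u hu =>
    ((h u hu).2.1.continuousAt.mul (h u hu).2.2.cos.continuousAt).sub
      ((h u hu).1.continuousAt.mul (h u hu).2.2.sin.continuousAt)
  have hp' : ∀ u ∈ Icc 0 b, 0 ≤ r u * Real.cos (θ u) - x u * Real.sin (θ u) := by
    intro u hu
    rcases hu.2.lt_or_eq with hub | rfl
    · exact (hp u ⟨hu.1, hub⟩).le
    · exact nonneg_of_nonneg_Ico (g := fun t => r t * Real.cos (θ t) - x t * Real.sin (θ t))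
        hb (hpd _ hu) fun v hv => (hp v hv).le
  have htI : t ∈ Icc 0 b := Ioc_subset_Icc_self ht
  have h0I : (0 : ℝ) ∈ Icc 0 b := ⟨le_rfl, hb.le⟩
  refine ⟨?_, ?_, ?_⟩
  · have hmono : StrictMonoOn (fun t => x t / r t) (Icc 0 b) := by
      refine strictMonoOn_of_deriv_pos (convex_Icc _ _)
        (fun u hu => (h.hasDerivAt_div hu (hr u hu).ne').continuousAt.continuousWithinAt) ?_
      intro u hu
      have huI := interior_subset hu
      rw [interior_Icc] at hu
      rw [(h.hasDerivAt_div huI (hr u huI).ne').deriv, neg_sub]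
      exact div_pos (hp u ⟨hu.1.le, hu.2⟩) (pow_pos (hr u huI) 2)
    have := hmono h0I htI ht.1
    simp only [hx0, zero_div] at this
    exact (div_pos_iff_of_pos_right (hr t htI)).1 this
  · have hne : ∀ u ∈ Icc 0 b, θ u ≠ -Real.pi := by
      intro u hu h1
      have h2 := hp' u hu
      have h3 := hr u hu
      simp [h1] at h2
      linarith
    have := nonpos_of_deriv_neg_of_eq_zero (g := fun t => -Real.pi - θ t)
      (fun u hu => ((h u hu).2.2.const_sub (-Real.pi)).continuousAt.continuousWithinAt)
      (fun u hu => (h u ⟨hu.1, hu.2.le⟩).2.2.const_sub (-Real.pi))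
      (by simp [hθ0, Real.pi_pos.le])
      (fun u hu h0 => absurd (by linarith) (hne u ⟨hu.1, hu.2.le⟩)) htI
    refine lt_of_le_of_ne (by linarith) (hne t htI).symm
  · refine neg_of_deriv_neg_of_eq_zero (fun u hu => (h u hu).2.2) hθ0.le ?_ ht
    intro u hu h0
    simpa [h0] using hneg u hu

/-- An arc starting horizontally at height `R` large cannot keep `r cos θ - x sin θ` positive up
to time `3`. -/
lemma not_support_pos {k m M R : ℝ} (hk : 1 ≤ k) (hm : 0 < m) (hmM : m ≤ M) (hR : 18 ≤ R)
    (hmR : 16 ≤ m * R) (hkR : 16 * k ≤ m * R ^ 2)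
    (hexp : 256 * M * R ^ 3 * Real.exp (-(m / 16) * R) < 1) {a x r θ : ℝ → ℝ}
    (h : SolvesArcSystem k a x r θ (Icc 0 3)) (hma : ∀ t, m ≤ a t) (haM : ∀ t, a t ≤ M)
    (hx0 : x 0 = 0) (hr0 : r 0 = R) (hθ0 : θ 0 = 0)
    (hp : ∀ t ∈ Icc 0 3, 0 < r t * Real.cos (θ t) - x t * Real.sin (θ t))
    (hreg : ∀ t ∈ Ioc 0 3, 0 < x t ∧ -Real.pi < θ t ∧ θ t < 0) : False := by
  have hM : 0 < M := hm.trans_le hmM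
  have hxle : ∀ t ∈ Icc (0 : ℝ) 3, 0 ≤ x t ∧ x t ≤ 3 := by
    intro t ht
    have := abs_sub_le_of_abs_deriv_le_one (fun u hu => (h u hu).1)
      (fun _ => Real.abs_cos_le_one _) ht
    rw [hx0, sub_zero] at this
    refine ⟨?_, (le_abs_self _).trans (this.trans ht.2)⟩
    rcases ht.1.lt_or_eq with h1 | rfl
    · exact (hreg t ⟨h1, ht.2⟩).1.le
    · exact hx0.ge
  have hrle : ∀ t ∈ Icc (0 : ℝ) 3, R - 3 ≤ r t ∧ r t ≤ R + 3 := by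
    intro t ht
    have := abs_le.1 (abs_sub_le_of_abs_deriv_le_one (fun u hu => (h u hu).2.1)
      (fun _ => Real.abs_sin_le_one _) ht)
    rw [hr0] at this
    exact ⟨by linarith [ht.2], by linarith [ht.2]⟩
  have hrpos : ∀ t ∈ Icc (0 : ℝ) 3, 0 < r t := fun t ht => by linarith [(hrle t ht).1]
  have hθle : ∀ t ∈ Icc (0 : ℝ) 3, -Real.pi ≤ θ t ∧ θ t ≤ 0 := by
    intro t ht
    rcases ht.1.lt_or_eq with h1 | rfl
    · exact ⟨(hreg t ⟨h1, ht.2⟩).2.1.le, (hreg t ⟨h1, ht.2⟩).2.2.le⟩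
    · rw [hθ0]; exact ⟨neg_nonpos.2 Real.pi_pos.le, le_rfl⟩
  have hsin : ∀ t ∈ Icc (0 : ℝ) 3, Real.sin (θ t) ≤ 0 := fun t ht =>
    Real.sin_nonpos_of_nonpos_of_neg_pi_le (hθle t ht).2 (hθle t ht).1
  set p : ℝ → ℝ := fun t => r t * Real.cos (θ t) - x t * Real.sin (θ t) with hpdef
  set θ' : ℝ → ℝ := fun t => (k / r t - r t / 2 * a t) * Real.cos (θ t)
        + x t / 2 * a t * Real.sin (θ t) with hθ'def
  have hθd : ∀ t ∈ Icc (0 : ℝ) 3, HasDerivAt θ (θ' t) t := fun t ht => (h t ht).2.2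
  have hpd : ∀ t ∈ Icc (0 : ℝ) 3,
      HasDerivAt p (-(x t * Real.cos (θ t) + r t * Real.sin (θ t)) * θ' t) t := by
    intro t ht
    have := (h.hasDerivAt_support ht).neg
    refine (this.congr_deriv (by simp only [hθ'def]; ring)).congr_of_eventuallyEq
      (Eventually.of_forall fun u => ?_)
    simp only [hpdef, Pi.neg_apply]
    ring
  have hkr : ∀ t ∈ Icc (0 : ℝ) 3, k / r t ^ 2 ≤ m / 4 := by
    intro t ht
    rw [div_le_div_iff₀ (pow_pos (hrpos t ht) 2) (by norm_num)]
    have h1 : R / 2 ≤ r t := by linarith [(hrle t ht).1]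
    have h2 : m * (R / 2) ^ 2 ≤ m * r t ^ 2 := by gcongr
    linarith
  -- bounds for `θ'`
  have hθ'1 : ∀ t ∈ Icc (0 : ℝ) 3, θ' t ≤ k * Real.cos (θ t) / r t := by
    intro t ht
    have e : θ' t = k * Real.cos (θ t) / r t - a t * p t / 2 := by
      simp only [hθ'def, hpdef]; ring
    have := mul_pos (hm.trans_le (hma t)) (hp t ht)
    rw [e]
    linarith
  have hθ'2 : ∀ t ∈ Icc (0 : ℝ) 3, θ' t ≤ -(m / 4) * p t := by
    intro t ht
    have hr := hrpos t ht
    have e : θ' t = k * Real.cos (θ t) / r t - a t * p t / 2 := by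
      simp only [hθ'def, hpdef]; ring
    have h1 : m * p t ≤ a t * p t := mul_le_mul_of_nonneg_right (hma t) (hp t ht).le
    have h2 : k * Real.cos (θ t) / r t ≤ k / r t ^ 2 * p t := by
      have h3 : r t * Real.cos (θ t) ≤ p t := by
        have := mul_nonpos_of_nonneg_of_nonpos (hxle t ht).1 (hsin t ht)
        simp only [hpdef]
        linarith
      calc k * Real.cos (θ t) / r t = k / r t ^ 2 * (r t * Real.cos (θ t)) := by field_simp
        _ ≤ _ := by gcongr
    have h4 : k / r t ^ 2 * p t ≤ m / 4 * p t := mul_le_mul_of_nonneg_right (hkr t ht) (hp t ht).le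
    rw [e]
    linarith
  have hθ'3 : ∀ t ∈ Icc (0 : ℝ) 3, -(M * R) ≤ θ' t := by
    intro t ht
    have hr := hrpos t ht
    have e : |θ' t| ≤ (k / r t + r t / 2 * M) + x t / 2 * M := by
      have ha : 0 < a t := hm.trans_le (hma t)
      have hx := (hxle t ht).1
      refine (abs_add_le _ _).trans (add_le_add ?_ ?_)
      · rw [abs_mul]
        refine (mul_le_of_le_one_right (abs_nonneg _) (Real.abs_cos_le_one _)).trans
          ((abs_sub _ _).trans (add_le_add ?_ ?_))
        · exact (abs_of_nonneg (by positivity)).le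
        · rw [abs_of_nonneg (by positivity)]
          exact mul_le_mul_of_nonneg_left (haM t) (by positivity)
      · rw [abs_mul]
        refine (mul_le_of_le_one_right (abs_nonneg _) (Real.abs_sin_le_one _)).trans ?_
        rw [abs_of_nonneg (by positivity)]
        exact mul_le_mul_of_nonneg_left (haM t) (by positivity)
    have h1 : k / r t ≤ M / 4 * r t := by
      calc k / r t = k / r t ^ 2 * r t := by field_simp
        _ ≤ m / 4 * r t := mul_le_mul_of_nonneg_right (hkr t ht) hr.le
        _ ≤ M / 4 * r t := by gcongr
    have h2 : M * r t ≤ M * (7 / 6 * R) := by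
      gcongr
      linarith [(hrle t ht).2]
    have h3 : M * x t ≤ M * (R / 6) := by
      gcongr
      linarith [(hxle t ht).2]
    have := neg_abs_le (θ' t)
    have := mul_pos hM (by linarith : 0 < R)
    linarith
  have hsub1 : Icc (0 : ℝ) 1 ⊆ Icc 0 3 := Icc_subset_Icc le_rfl (by norm_num)
  have hsub2 : Icc (1 : ℝ) 3 ⊆ Icc 0 3 := Icc_subset_Icc (by norm_num) le_rfl
  have hsub3 : Icc (2 : ℝ) 3 ⊆ Icc 1 3 := Icc_subset_Icc (by norm_num) le_rfl
  have hθanti : AntitoneOn θ (Icc 0 3) := antitoneOn_Icc_of_hasDerivAt_nonpos hθd fun t ht =>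
    (hθ'2 t ht).trans (by have := mul_pos hm (hp t ht); linarith)
  have hpi := Real.pi_gt_three
  have hpi4 := Real.pi_le_four
  -- the angle at time `1`
  have hθ1 : θ 1 ≤ -(Real.pi / 6) := by
    by_contra hlt
    push Not at hlt
    have hge : ∀ t ∈ Icc (0 : ℝ) 1, -(Real.pi / 6) ≤ θ t := fun t ht =>
      hlt.le.trans (hθanti (hsub1 ht) ⟨by norm_num, by norm_num⟩ ht.2)
    have := antitoneOn_Icc_of_hasDerivAt_nonpos (g := fun t => θ t + t)
      (fun t ht => (hθd t (hsub1 ht)).add (hasDerivAt_id t)) (fun t ht => ?_)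
      (⟨le_rfl, by norm_num⟩ : (0 : ℝ) ∈ Icc 0 1) (⟨by norm_num, le_rfl⟩ : (1 : ℝ) ∈ Icc 0 1)
      zero_le_one
    · simp only [hθ0] at this
      linarith
    · have hc : 1 / 2 ≤ Real.cos (θ t) := by
        rw [← Real.cos_neg, ← Real.cos_pi_div_three]
        exact Real.cos_le_cos_of_nonneg_of_le_pi (by linarith [(hθle t (hsub1 ht)).2])
          (by linarith) (by linarith [hge t ht])
      have h1 : R / 4 ≤ p t := by
        have h2 := mul_nonpos_of_nonneg_of_nonpos (hxle t (hsub1 ht)).1 (hsin t (hsub1 ht))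
        have h3 : R / 2 * (1 / 2) ≤ r t * Real.cos (θ t) := by
          have := (hrle t (hsub1 ht)).1
          gcongr
          · exact (hrpos t (hsub1 ht)).le
          · linarith
        simp only [hpdef]
        linarith
      have h2 := hθ'2 t (hsub1 ht)
      have h3 : m / 4 * (R / 4) ≤ m / 4 * p t := by gcongr
      linarith
  have hsin2 : ∀ t ∈ Icc (1 : ℝ) 3, Real.sin (θ t) ≤ -(1 / 2) := by
    intro t ht
    have ht' := hsub2 ht
    have hθt : θ t ≤ -(Real.pi / 6) := (hθanti ⟨by norm_num, by norm_num⟩ ht' ht.1).trans hθ1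
    rcases le_total (-(Real.pi / 2)) (θ t) with h1 | h1
    · rw [← Real.sin_pi_div_six, ← Real.sin_neg]
      exact Real.sin_le_sin_of_le_of_le_pi_div_two h1 (by linarith) hθt
    · have hc : Real.cos (θ t) ≤ 0 := by
        rw [← Real.cos_neg]
        exact Real.cos_nonpos_of_pi_div_two_le_of_le (by linarith) (by linarith [(hθle t ht').1])
      have hs := Real.neg_one_le_sin (θ t)
      have h2 := hp t ht'
      have h3 : x t * -Real.sin (θ t) ≤ 3 * 1 := by
        have := (hxle t ht').2
        have := hsin t ht'
        gcongr <;> linarith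
      have h4 : 15 * -Real.cos (θ t) ≤ r t * -Real.cos (θ t) := by
        have := (hrle t ht').1
        gcongr
        · linarith
        · linarith
      nlinarith [Real.sin_sq_add_cos_sq (θ t), hsin t ht']
  have hQ : ∀ t ∈ Icc (1 : ℝ) 3,
      R / 4 ≤ -(x t * Real.cos (θ t) + r t * Real.sin (θ t)) := by
    intro t ht
    have ht' := hsub2 ht
    have h1 : x t * Real.cos (θ t) ≤ 3 * 1 := by
      refine (mul_le_mul_of_nonneg_left (Real.cos_le_one _) (hxle t ht').1).trans ?_
      linarith [(hxle t ht').2]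
    have h2 : (R - 3) * (1 / 2) ≤ r t * -Real.sin (θ t) := by
      have := hsin2 t ht
      have := (hrle t ht').1
      have := hrpos t ht'
      gcongr
      linarith
    linarith
  -- exponential decay
  have hp'1 : ∀ t ∈ Icc (1 : ℝ) 3,
      -(x t * Real.cos (θ t) + r t * Real.sin (θ t)) * θ' t ≤ -(m / 16 * R) * p t := by
    intro t ht
    have h1 := mul_le_mul_of_nonneg_left (hθ'2 t (hsub2 ht))
      ((by linarith : 0 ≤ R / 4).trans (hQ t ht))
    have h2 : 0 < m / 4 * p t := mul_pos (by linarith) (hp t (hsub2 ht))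
    have h3 := mul_le_mul_of_nonneg_right (hQ t ht) h2.le
    linarith
  have hpanti : AntitoneOn p (Icc 1 3) :=
    antitoneOn_Icc_of_hasDerivAt_nonpos (fun t ht => hpd t (hsub2 ht)) fun t ht =>
      (hp'1 t ht).trans (by
        have : 0 < R := by linarith
        have := mul_pos (by positivity : 0 < m / 16 * R) (hp t (hsub2 ht))
        linarith)
  have hp2 : p 2 ≤ 2 * R * Real.exp (-(m / 16) * R) := by
    have := antitoneOn_Icc_of_hasDerivAt_nonpos
      (g := fun t => p t * Real.exp (m / 16 * R * (t - 1)))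
      (fun t ht => (hpd t (hsub2 ht)).mul
        (((hasDerivAt_id t).sub_const 1).const_mul (m / 16 * R)).exp) (fun t ht => ?_)
      (⟨le_rfl, by norm_num⟩ : (1 : ℝ) ∈ Icc 1 3) (⟨by norm_num, by norm_num⟩ : (2 : ℝ) ∈ Icc 1 3)
      one_le_two
    · have h1 : p 1 ≤ 2 * R := by
        have h1I : (1 : ℝ) ∈ Icc 0 3 := ⟨by norm_num, by norm_num⟩
        have h1 := hxle 1 h1I
        have h2 := hrle 1 h1I
        have h3 := mul_le_mul_of_nonneg_left (Real.cos_le_one (θ 1)) (hrpos 1 h1I).le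
        have h4 := mul_le_mul_of_nonneg_left (Real.neg_one_le_sin (θ 1)) h1.1
        simp only [hpdef]
        linarith
      have e1 : m / 16 * R * (2 - 1) = m / 16 * R := by ring
      simp only [sub_self, mul_zero, Real.exp_zero, mul_one, e1] at this
      rw [neg_mul, Real.exp_neg, ← div_eq_mul_inv, le_div_iff₀ (Real.exp_pos _)]
      exact this.trans h1
    · have h1 := mul_le_mul_of_nonneg_right (hp'1 t ht)
        (Real.exp_pos (m / 16 * R * (t - 1))).le
      simp only [id] at *
      linarith
  -- lower bound for `x / r`
  have hMR : 1 ≤ M * R := by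
    have : m * R ≤ M * R := by gcongr
    linarith
  have hMR0 : 0 < M * R := by linarith
  have ht2 : 1 / (M * R) ≤ 1 := by rwa [div_le_one hMR0]
  have ht2' : 0 < 1 / (M * R) := by positivity
  set τ := 1 / (M * R) with hτ
  have hsubτ : Icc 0 τ ⊆ Icc 0 3 := Icc_subset_Icc le_rfl (by linarith)
  have hθτ : ∀ t ∈ Icc 0 τ, -1 ≤ θ t := by
    intro t ht
    have := antitoneOn_Icc_of_hasDerivAt_nonpos (g := fun t => -θ t + -(M * R * t))
      (fun t ht => (hθd t (hsubτ ht)).neg.add ((hasDerivAt_id t).const_mul (M * R)).neg)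
      (fun t ht => by linarith [hθ'3 t (hsubτ ht)])
      (⟨le_rfl, ht2'.le⟩ : (0 : ℝ) ∈ Icc 0 τ) ht ht.1
    simp only [hθ0] at this
    have h1 : M * R * t ≤ M * R * τ := mul_le_mul_of_nonneg_left ht.2 hMR0.le
    have h2 : M * R * τ = 1 := by rw [hτ]; field_simp
    linarith
  have hxτ : τ / 2 ≤ x τ := by
    have := antitoneOn_Icc_of_hasDerivAt_nonpos (g := fun t => t / 2 - x t)
      (fun t ht => ((hasDerivAt_id t).div_const 2).sub (h t (hsubτ ht)).1) (fun t ht => ?_)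
      (⟨le_rfl, ht2'.le⟩ : (0 : ℝ) ∈ Icc 0 τ) (⟨ht2'.le, le_rfl⟩ : τ ∈ Icc 0 τ) ht2'.le
    · simp only [hx0] at this
      linarith
    · have hc : 1 / 2 ≤ Real.cos (θ t) := by
        rw [← Real.cos_neg, ← Real.cos_pi_div_three]
        exact Real.cos_le_cos_of_nonneg_of_le_pi (by linarith [(hθle t (hsubτ ht)).2])
          (by linarith) (by linarith [hθτ t ht])
      linarith
  have hratio : ∀ t ∈ Icc (2 : ℝ) 3, 1 / (4 * M * R ^ 2) ≤ x t / r t := by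
    intro t ht
    have hmono : AntitoneOn (fun t => -(x t / r t)) (Icc 0 3) :=
      antitoneOn_Icc_of_hasDerivAt_nonpos
        (fun u hu => (h.hasDerivAt_div hu (hrpos u hu).ne').neg) (fun u hu => by
          have := div_pos (hp u hu) (pow_pos (hrpos u hu) 2)
          rw [neg_sub]
          linarith)
    have hτI : τ ∈ Icc (0 : ℝ) 3 := ⟨ht2'.le, by linarith⟩
    have h1 := hmono hτI (hsub2 (hsub3 ht)) (by linarith [ht.1])
    have h2 : 1 / (4 * M * R ^ 2) ≤ x τ / r τ := by
      rw [div_le_div_iff₀ (by positivity) (hrpos τ hτI)]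
      have h3 : r τ ≤ 2 * R := by linarith [(hrle τ hτI).2]
      have h4 : τ / 2 * (4 * M * R ^ 2) ≤ x τ * (4 * M * R ^ 2) := by gcongr
      have h5 : τ / 2 * (4 * M * R ^ 2) = 2 * R := by rw [hτ]; field_simp; norm_num
      linarith
    linarith
  -- linear decrease on `[2, 3]`
  have hp2' : 128 * M * R ^ 2 * p 2 < 1 := by
    have : 128 * M * R ^ 2 * p 2 ≤ 128 * M * R ^ 2 * (2 * R * Real.exp (-(m / 16) * R)) := by
      gcongr
    linarith
  have hcos : ∀ t ∈ Icc (2 : ℝ) 3, Real.cos (θ t) ≤ -(1 / (16 * M * R ^ 2)) := by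
    intro t ht
    have ht1 := hsub3 ht
    have ht' := hsub2 ht1
    have hr := hrpos t ht'
    have e : Real.cos (θ t) = p t / r t + x t / r t * Real.sin (θ t) := by
      simp only [hpdef]; field_simp; ring
    have h1 : p t / r t ≤ 1 / (16 * M * R ^ 2) := by
      rw [div_le_div_iff₀ hr (by positivity)]
      have h2 : p t ≤ p 2 := hpanti ⟨by norm_num, by norm_num⟩ ht1 ht.1
      have h3 : p t * (16 * M * R ^ 2) ≤ p 2 * (16 * M * R ^ 2) := by gcongr
      linarith [(hrle t ht').1]
    have h2 : 1 / (4 * M * R ^ 2) * (1 / 2) ≤ x t / r t * -Real.sin (θ t) := by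
      have h3 := hsin2 t ht1
      have h4 := hratio t ht
      have h5 : 0 ≤ x t / r t := div_nonneg (hxle t ht').1 hr.le
      gcongr
      linarith
    have h3 : 1 / (4 * M * R ^ 2) * (1 / 2) = 2 * (1 / (16 * M * R ^ 2)) := by
      field_simp; norm_num
    linarith
  have hp3 := antitoneOn_Icc_of_hasDerivAt_nonpos
    (g := fun t => p t + 1 / (128 * M * R ^ 2) * t)
    (fun t ht => (hpd t (hsub2 (hsub3 ht))).add
      ((hasDerivAt_id t).const_mul (1 / (128 * M * R ^ 2)))) (fun t ht => ?_)
    (⟨le_rfl, by norm_num⟩ : (2 : ℝ) ∈ Icc 2 3) (⟨by norm_num, le_rfl⟩ : (3 : ℝ) ∈ Icc 2 3)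
    (by norm_num)
  · have h1 : p 2 < 1 / (128 * M * R ^ 2) := by
      rw [lt_div_iff₀ (by positivity)]
      linarith
    have h2 := hp 3 ⟨by norm_num, le_rfl⟩
    change 0 < p 3 at h2
    simp only at hp3
    linarith
  · have ht1 := hsub3 ht
    have ht' := hsub2 ht1
    have hr := hrpos t ht'
    have h1 : θ' t ≤ -(1 / (32 * M * R ^ 3)) := by
      refine (hθ'1 t ht').trans ?_
      have h2 : 1 / (16 * M * R ^ 2) ≤ -Real.cos (θ t) := by linarith [hcos t ht]
      have h3 : 1 / (32 * M * R ^ 3) ≤ k * -Real.cos (θ t) / r t := by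
        calc 1 / (32 * M * R ^ 3) = 1 * (1 / (16 * M * R ^ 2)) / (2 * R) := by
              field_simp; norm_num
          _ ≤ k * -Real.cos (θ t) / r t := by
            have h5 : r t ≤ 2 * R := by linarith [(hrle t ht').2]
            have h6 : 0 ≤ -Real.cos (θ t) := le_trans (by positivity) h2
            gcongr
      have h4 : k * -Real.cos (θ t) / r t = -(k * Real.cos (θ t) / r t) := by ring
      linarith
    have h2 : R / 4 * (1 / (32 * M * R ^ 3)) ≤
        -(x t * Real.cos (θ t) + r t * Real.sin (θ t)) * -θ' t := by
      have h5 := hQ t ht1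
      have h6 : 1 / (32 * M * R ^ 3) ≤ -θ' t := by linarith
      have h7 : 0 ≤ -(x t * Real.cos (θ t) + r t * Real.sin (θ t)) := by linarith
      gcongr
    have h3 : R / 4 * (1 / (32 * M * R ^ 3)) = 1 / (128 * M * R ^ 2) := by
      field_simp; norm_num
    rw [h3] at h2
    linarith

lemma exists_first_nonpos {g : ℝ → ℝ} {a b : ℝ} (hg : ContinuousOn g (Icc a b))
    (h : ∃ t ∈ Icc a b, g t ≤ 0) :
    ∃ t₀ ∈ Icc a b, g t₀ ≤ 0 ∧ ∀ t ∈ Ico a t₀, 0 < g t := by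
  obtain ⟨t₀, ht₀, hmin⟩ := ((isCompact_Icc (a := a) (b := b)).of_isClosed_subset
    (hg.preimage_isClosed_of_isClosed isClosed_Icc isClosed_Iic)
    inter_subset_left).exists_isLeast (s := Icc a b ∩ g ⁻¹' Iic 0)
    (by obtain ⟨t, ht, h0⟩ := h; exact ⟨t, ht, h0⟩)
  refine ⟨t₀, ht₀.1, ht₀.2, fun t ht => ?_⟩
  by_contra h0
  exact ht.2.not_ge (hmin ⟨⟨ht.1, ht.2.le.trans ht₀.1.2⟩, not_lt.1 h0⟩)

/-- An arc starting horizontally at large height becomes radial within time `3`, before leaving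
the region `x > 0`, `-π < θ < 0`. -/
lemma exists_radial_time {k m M : ℝ} (hk : 1 ≤ k) (hm : 0 < m) (hmM : m ≤ M) :
    ∃ R₁, ∀ R ≥ R₁, ∀ a x r θ : ℝ → ℝ, SolvesArcSystem k a x r θ (Icc 0 3) →
      (∀ t, m ≤ a t) → (∀ t, a t ≤ M) → x 0 = 0 → r 0 = R → θ 0 = 0 →
      ∃ t₀ ∈ Ioc (0 : ℝ) 3, x t₀ * Real.sin (θ t₀) = r t₀ * Real.cos (θ t₀) ∧
        ∀ t ∈ Ioc 0 t₀, 0 < x t ∧ -Real.pi < θ t ∧ θ t < 0 := by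
  have hexp : ∀ᶠ R : ℝ in atTop, 256 * M * R ^ 3 * Real.exp (-(m / 16) * R) < 1 := by
    have h1 := (tendsto_rpow_mul_exp_neg_mul_atTop_nhds_zero 3 (m / 16)
      (by positivity)).const_mul (256 * M)
    rw [mul_zero] at h1
    filter_upwards [h1.eventually_lt_const one_pos] with R hR
    rw [show (3 : ℝ) = (3 : ℕ) by norm_num, Real.rpow_natCast] at hR
    rwa [mul_assoc]
  have hsq : ∀ᶠ R : ℝ in atTop, 16 * k ≤ m * R ^ 2 :=
    ((tendsto_pow_atTop two_ne_zero).const_mul_atTop hm).eventually_ge_atTop _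
  have hlin : ∀ᶠ R : ℝ in atTop, 16 ≤ m * R :=
    (tendsto_id.const_mul_atTop hm).eventually_ge_atTop _
  obtain ⟨R₁, hR₁⟩ := eventually_atTop.1 (hexp.and (hsq.and (hlin.and (eventually_ge_atTop 18))))
  refine ⟨R₁, fun R hR a x r θ h hma haM hx0 hr0 hθ0 => ?_⟩
  obtain ⟨h1, h2, h3, h4⟩ := hR₁ R hR
  have hrle : ∀ t ∈ Icc (0 : ℝ) 3, R / 2 ≤ r t := by
    intro t ht
    have := abs_le.1 (abs_sub_le_of_abs_deriv_le_one (fun u hu => (h u hu).2.1)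
      (fun _ => Real.abs_sin_le_one _) ht)
    rw [hr0] at this
    linarith [ht.2]
  have hrpos : ∀ t ∈ Icc (0 : ℝ) 3, 0 < r t := fun t ht => by linarith [hrle t ht]
  have hneg : ∀ t ∈ Icc (0 : ℝ) 3, k / r t - r t / 2 * a t < 0 := by
    intro t ht
    have hr := hrpos t ht
    have h5 : r t / 2 * m ≤ r t / 2 * a t := mul_le_mul_of_nonneg_left (hma t) (by positivity)
    have h6 : k / r t < r t / 2 * m := by
      rw [div_lt_iff₀ hr]
      have h7 : m * (R / 2) ^ 2 ≤ m * r t ^ 2 := by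
        have := hrle t ht
        gcongr
      linarith
    linarith
  have hcont : ContinuousOn (fun t => r t * Real.cos (θ t) - x t * Real.sin (θ t)) (Icc 0 3) :=
    fun u hu => (((h u hu).2.1.continuousAt.mul (h u hu).2.2.cos.continuousAt).sub
      ((h u hu).1.continuousAt.mul (h u hu).2.2.sin.continuousAt)).continuousWithinAt
  have hex : ∃ t ∈ Icc (0 : ℝ) 3, r t * Real.cos (θ t) - x t * Real.sin (θ t) ≤ 0 := by
    by_contra! hp
    exact not_support_pos hk hm hmM h4 h3 h2 h1 h hma haM hx0 hr0 hθ0 hp fun t ht =>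
      pos_and_angle_mem_of_support_pos (by norm_num) h hrpos hneg hx0 hθ0
        (fun u hu => hp u ⟨hu.1, hu.2.le⟩) ht
  obtain ⟨t₀, ht₀, hle, hpos⟩ := exists_first_nonpos hcont hex
  have ht₀pos : 0 < t₀ := by
    refine ht₀.1.lt_of_ne fun h0 => ?_
    simp only [← h0, hx0, hr0, hθ0, Real.cos_zero] at hle
    linarith
  have hge := nonneg_of_nonneg_Ico
    (g := fun t => r t * Real.cos (θ t) - x t * Real.sin (θ t)) ht₀pos
    (((h t₀ ht₀).2.1.continuousAt.mul (h t₀ ht₀).2.2.cos.continuousAt).sub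
      ((h t₀ ht₀).1.continuousAt.mul (h t₀ ht₀).2.2.sin.continuousAt))
    (fun t ht => (hpos t ht).le)
  have hsub : Icc 0 t₀ ⊆ Icc 0 3 := Icc_subset_Icc le_rfl ht₀.2
  exact ⟨t₀, ⟨ht₀pos, ht₀.2⟩, by linarith, fun t ht =>
    pos_and_angle_mem_of_support_pos ht₀pos (h.mono hsub) (fun u hu => hrpos u (hsub hu))
      (fun u hu => hneg u (hsub hu)) hx0 hθ0 hpos ht⟩

end ShrinkerArc

open ShrinkerArc

/-- For all sufficiently large `R` the first exit time `t₁(R)` is finite, the exit occurs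
through the `r`-axis (`x = 0` with `θ ∈ (-π, 0)`), and `r` at exit is bounded below by a
uniform `δ > 0`. -/
theorem exit_through_r_axis
    (n : ℕ) (hn : 2 ≤ n) (m M : ℝ) (hm : 0 < m) (hmM : m ≤ M)
    (f : ℝ → ℝ) (hf : ContDiff ℝ 2 f)
    (hconv : ∀ s : ℝ, 0 ≤ deriv (deriv f) s)
    (hlow : ∀ s : ℝ, m ≤ deriv f s) (hup : ∀ s : ℝ, deriv f s ≤ M) :
    ∃ δ R₀ : ℝ, 0 < δ ∧ 0 < R₀ ∧
      ∀ R : ℝ, R₀ ≤ R →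
        ∃ x r θ : ℝ → ℝ, ∃ t₁ : ℝ, 0 < t₁ ∧
          x 0 = 0 ∧ r 0 = R ∧ θ 0 = 0 ∧
          SolvesSystem n f x r θ (Set.Icc 0 t₁) ∧
          NoExit x r θ (Set.Ioo 0 t₁) ∧
          x t₁ = 0 ∧ θ t₁ ∈ Set.Ioo (-Real.pi) 0 ∧ δ ≤ r t₁ := by
  have hM : 0 < M := hm.trans_le hmM
  have hk : (1 : ℝ) ≤ (n : ℝ) - 1 := by
    have : (2 : ℝ) ≤ n := by exact_mod_cast hn
    linarith
  obtain ⟨δ, hδ, hδ1, hMδ⟩ : ∃ δ > 0, δ ≤ 1 ∧ 100 * M * δ ^ 2 ≤ 1 := by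
    refine ⟨1 / (10 * (M + 1)), by positivity, ?_, ?_⟩
    · rw [div_le_one (by positivity)]
      linarith
    · rw [div_pow, one_pow, mul_one_div, div_le_iff₀ (by positivity)]
      nlinarith
  obtain ⟨σ, hσ, hdesc⟩ := exists_descent_bounds hk hm hδ hMδ
  obtain ⟨R₁, hR₁⟩ := exists_radial_time hk hm hmM
  refine ⟨δ, max R₁ (3 / σ + 20), hδ, lt_max_of_lt_right (by positivity), fun R hR => ?_⟩
  have hRσ : 3 / σ + 20 ≤ R := (le_max_right _ _).trans hR
  have hR20 : 20 ≤ R := by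
    have : 0 < 3 / σ := by positivity
    linarith
  obtain ⟨x, r, θ, hx0, hr0, hθ0, hsol⟩ := exists_arclength_solution n hm hf hlow hup
    (T := 2 * R + 20) hδ (by linarith : δ ≤ R) (by linarith)
  set T := 2 * R + 20 with hT
  have hsys : ∀ {s : Set ℝ}, s ⊆ Set.Icc 0 T → (∀ t ∈ s, δ ≤ r t) →
      SolvesArcSystem ((n : ℝ) - 1) (fun t => deriv f (x t ^ 2 + r t ^ 2)) x r θ s :=
    fun hs hr t ht => ⟨(hsol t (hs ht)).1, (hsol t (hs ht)).2.1, (hsol t (hs ht)).2.2.2 (hr t ht)⟩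
  have h3T : Set.Icc (0 : ℝ) 3 ⊆ Set.Icc 0 T := Set.Icc_subset_Icc le_rfl (by linarith)
  have hrle : ∀ t ∈ Set.Icc (0 : ℝ) 3, R - 3 ≤ r t ∧ r t ≤ R + 3 := by
    intro t ht
    have := abs_le.1 (abs_sub_le_of_abs_deriv_le_one (fun u hu => (hsol u hu).2.1)
      (fun _ => Real.abs_sin_le_one _) (h3T ht))
    rw [hr0] at this
    exact ⟨by linarith [ht.2], by linarith [ht.2]⟩
  obtain ⟨t₀, ht₀, hrad, hinit⟩ := hR₁ R ((le_max_left _ _).trans hR) _ x r θ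
    (hsys h3T fun t ht => by linarith [(hrle t ht).1]) (fun t => hlow _) (fun t => hup _)
    hx0 hr0 hθ0
  have ht₀3 : t₀ ∈ Set.Icc (0 : ℝ) 3 := Set.Ioc_subset_Icc_self ht₀
  obtain ⟨hxt₀, hθt₀, hθt₀'⟩ := hinit t₀ ⟨ht₀.1, le_rfl⟩
  have hxt₀3 : x t₀ ≤ 3 := by
    have := abs_le.1 (abs_sub_le_of_abs_deriv_le_one (fun u hu => (hsol u hu).1)
      (fun _ => Real.abs_cos_le_one _) (h3T ht₀3))
    linarith [ht₀.2]
  have hrt₀ := hrle t₀ ht₀3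
  have hst₀ : Real.sin (θ t₀) < -(1 / 2) := by
    have hs := Real.sin_neg_of_neg_of_neg_pi_lt hθt₀' hθt₀
    have hs1 := Real.neg_one_le_sin (θ t₀)
    have hc : Real.cos (θ t₀) ≤ 0 := by
      by_contra h
      have := mul_pos (by linarith : 0 < r t₀) (not_le.1 h)
      have := mul_neg_of_pos_of_neg hxt₀ hs
      linarith
    have h1 : x t₀ * -Real.sin (θ t₀) ≤ 3 * 1 := by
      gcongr <;> linarith
    have h2 : 17 * -Real.cos (θ t₀) ≤ r t₀ * -Real.cos (θ t₀) :=
      mul_le_mul_of_nonneg_right (by linarith) (by linarith)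
    nlinarith [Real.sin_sq_add_cos_sq (θ t₀)]
  have hsubT : Set.Icc t₀ T ⊆ Set.Icc 0 T := Set.Icc_subset_Icc ht₀.1.le le_rfl
  have hex : ∃ t ∈ Set.Icc t₀ T,
      min (x t) (min (r t - δ) (-(1 / 2) - Real.sin (θ t))) ≤ 0 := by
    by_contra! hpos
    have ht₀T : t₀ ≤ T := by linarith [ht₀.2]
    have := antitoneOn_Icc_of_hasDerivAt_nonpos (g := fun t => r t + t / 2)
      (fun t ht => (hsol t (hsubT ht)).2.1.add ((hasDerivAt_id t).div_const 2))
      (fun t ht => by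
        have := (lt_min_iff.1 (lt_min_iff.1 (hpos t ht)).2).2
        linarith) (⟨le_rfl, ht₀T⟩ : t₀ ∈ Set.Icc t₀ T) (⟨ht₀T, le_rfl⟩ : T ∈ Set.Icc t₀ T) ht₀T
    have h1 := (lt_min_iff.1 (lt_min_iff.1 (hpos T ⟨ht₀T, le_rfl⟩)).2).1
    simp only at this
    linarith [ht₀.2]
  have hcont : ContinuousOn
      (fun t => min (x t) (min (r t - δ) (-(1 / 2) - Real.sin (θ t)))) (Set.Icc t₀ T) := by
    have hx : ContinuousOn x (Set.Icc t₀ T) := fun t ht =>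
      (hsol t (hsubT ht)).1.continuousAt.continuousWithinAt
    have hr : ContinuousOn r (Set.Icc t₀ T) := fun t ht =>
      (hsol t (hsubT ht)).2.1.continuousAt.continuousWithinAt
    have hθ : ContinuousOn θ (Set.Icc t₀ T) := fun t ht =>
      (hsol t (hsubT ht)).2.2.1.continuousWithinAt
    fun_prop
  obtain ⟨t₁, ht₁, hle, hgood⟩ := exists_first_nonpos hcont hex
  simp only [lt_min_iff, min_le_iff, sub_pos, sub_nonpos] at hle hgood
  have h01 : t₀ < t₁ := by
    refine ht₁.1.lt_of_ne fun h => ?_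
    rw [← h] at hle
    rcases hle with h | h | h <;> linarith
  have ht₁T := hsubT ht₁
  have hr₁ : δ ≤ r t₁ := sub_nonneg.1 (nonneg_of_nonneg_Ico (g := fun t => r t - δ) h01
    ((hsol t₁ ht₁T).2.1.continuousAt.sub continuousAt_const)
    fun t ht => (sub_pos.2 (hgood t ht).2.1).le)
  have hx₁ : 0 ≤ x t₁ := nonneg_of_nonneg_Ico h01 (hsol t₁ ht₁T).1.continuousAt
    fun t ht => (hgood t ht).1.le
  have hrδ : ∀ t ∈ Set.Icc 0 t₁, δ ≤ r t := by
    intro t ht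
    rcases le_or_gt t t₀ with h | h
    · linarith [(hrle t ⟨ht.1, h.trans ht₀.2⟩).1]
    · rcases ht.2.lt_or_eq with h' | rfl
      · exact (hgood t ⟨h.le, h'⟩).2.1.le
      · exact hr₁
  have hS := hsys (Set.Icc_subset_Icc le_rfl ht₁.2) hrδ
  have hsub : Set.Icc t₀ t₁ ⊆ Set.Icc 0 t₁ := Set.Icc_subset_Icc ht₀.1.le le_rfl
  have hσR : 3 ≤ σ * (R - 3) := by
    have : 3 / σ ≤ R - 3 := by linarith
    rw [div_le_iff₀ hσ] at this
    linarith
  obtain ⟨⟨hsc, hc⟩, hδx⟩ := hdesc _ x r θ t₀ t₁ h01 (hS.mono hsub) (fun t => hlow _)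
    (fun t => hup _) (fun t ht => hrδ t (hsub ht))
    (fun t ht => ⟨(hgood t ht).1, by linarith [(hgood t ht).2.2]⟩) hrad
    (hxt₀3.trans (hσR.trans (mul_le_mul_of_nonneg_left hrt₀.1 hσ.le))) (by linarith)
  have hs₁ : Real.sin (θ t₁) < -(1 / 2) := by
    nlinarith [Real.sin_sq_add_cos_sq (θ t₁)]
  have hsin : ∀ t ∈ Set.Icc t₀ t₁, Real.sin (θ t) < 0 := by
    intro t ht
    rcases ht.2.lt_or_eq with h | rfl
    · linarith [(hgood t ⟨ht.1, h⟩).2.2]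
    · linarith
  have hθ : ∀ t ∈ Set.Icc t₀ t₁, -Real.pi < θ t ∧ θ t < 0 := by
    have hd : ∀ u ∈ Set.Icc t₀ t₁, HasDerivAt θ _ u := fun u hu => (hS u (hsub hu)).2.2
    have hne : ∀ u ∈ Set.Icc t₀ t₁, θ u ≠ 0 ∧ θ u ≠ -Real.pi := fun u hu =>
      ⟨fun h => by simpa [h] using hsin u hu, fun h => by simpa [h] using hsin u hu⟩
    intro t ht
    constructor
    · have := nonpos_of_deriv_neg_of_eq_zero (g := fun t => -Real.pi - θ t)
        (fun u hu => ((hd u hu).const_sub (-Real.pi)).continuousAt.continuousWithinAt)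
        (fun u hu => (hd u ⟨hu.1, hu.2.le⟩).const_sub (-Real.pi)) (by linarith)
        (fun u hu h0 => absurd (by linarith) (hne u ⟨hu.1, hu.2.le⟩).2) ht
      exact lt_of_le_of_ne (by linarith) (hne t ht).2.symm
    · have := nonpos_of_deriv_neg_of_eq_zero (g := θ)
        (fun u hu => (hd u hu).continuousAt.continuousWithinAt)
        (fun u hu => hd u ⟨hu.1, hu.2.le⟩) hθt₀'.le
        (fun u hu h0 => absurd h0 (hne u ⟨hu.1, hu.2.le⟩).1) ht
      exact this.lt_of_ne (hne t ht).1
  have hx₁0 : x t₁ = 0 := by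
    refine le_antisymm ?_ hx₁
    rcases hle with h | h | h
    · exact h
    · by_contra hx
      have := mul_neg_of_pos_of_neg (not_le.1 hx) (by linarith : Real.sin (θ t₁) < 0)
      linarith [hδx (le_antisymm h hr₁)]
    · linarith
  refine ⟨x, r, θ, t₁, ht₀.1.trans h01, hx0, hr0, hθ0, hS, fun t ht => ?_, hx₁0,
    hθ t₁ ⟨h01.le, le_rfl⟩, hr₁⟩
  have hrt := hδ.trans_le (hrδ t ⟨ht.1.le, ht.2.le⟩)
  rcases le_total t t₀ with h | h
  · obtain ⟨h1, h2, h3⟩ := hinit t ⟨ht.1, h⟩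
    exact ⟨h3.ne, h2.ne', h1.ne', hrt.ne'⟩
  · obtain ⟨h2, h3⟩ := hθ t ⟨h, ht.2.le⟩
    exact ⟨h3.ne, h2.ne', (hgood t ⟨h, ht.2⟩).1.ne', hrt.ne'⟩
end

section
/- Suppose R* > 0 is such that for every R ∈ [R*, R* + 1] the first exit time t₁(R) is finite and x_R(t₁(R)) = 0. Then inf { r_R(t₁(R)) : R ∈ [R*, R* + 1] } > 0. -/
open Set Filter Topology Metric

/-- Solutions of an autonomous `C¹` system depend continuously on the initial value, uniformly
on compact time intervals; the perturbed solution is not assumed to stay in the domain `U`. -/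
theorem exists_forall_dist_lt_of_dist_initial_lt {E : Type*} [NormedAddCommGroup E]
    [NormedSpace ℝ E] [ProperSpace E] {U : Set E} (hUo : IsOpen U) (hUc : Convex ℝ U)
    {v : E → E} (hv : ContDiffOn ℝ 1 v U) {u : ℝ → E} {a b : ℝ}
    (hu : ContinuousOn u (Icc a b))
    (hu' : ∀ t ∈ Ico a b, HasDerivWithinAt u (v (u t)) (Ici t) t)
    (huU : ∀ t ∈ Icc a b, u t ∈ U) {ρ : ℝ} (hρ : 0 < ρ) :
    ∃ ε > 0, ∀ c ≤ b, ∀ w : ℝ → E, ContinuousOn w (Icc a c) →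
      (∀ t ∈ Ico a c, HasDerivWithinAt w (v (w t)) (Ici t) t) → dist (u a) (w a) < ε →
      ∀ t ∈ Icc a c, dist (u t) (w t) < ρ := by
  have hcpt : IsCompact (u '' Icc a b) := isCompact_Icc.image_of_continuousOn hu
  obtain ⟨η, hη, hηU⟩ := hcpt.exists_cthickening_subset_open hUo (by
    rintro _ ⟨t, ht, rfl⟩; exact huU t ht)
  obtain ⟨K, hK⟩ := LocallyLipschitzOn.exists_lipschitzOnWith_of_compact
    (hcpt.cthickening (r := η)) ((hv.locallyLipschitzOn hUc).mono hηU)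
  set σ := min ρ η with hσ
  have hσ0 : 0 < σ := lt_min hρ hη
  refine ⟨σ * Real.exp (-(K * |b - a|)), by positivity, fun c hcb w hw hw' hd t ht => ?_⟩
  refine lt_of_lt_of_le ?_ (min_le_left ρ η)
  by_contra hcon
  have hdc : ContinuousOn (fun s => dist (u s) (w s)) (Icc a c) :=
    continuous_dist.comp_continuousOn ((hu.mono (Icc_subset_Icc_right hcb)).prodMk hw)
  obtain ⟨τ, ⟨hτ, hτσ⟩, hleast⟩ := (IsCompact.exists_isLeast
    (s := Icc a c ∩ (fun s => dist (u s) (w s)) ⁻¹' Ici σ)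
    (isCompact_Icc.of_isClosed_subset (hdc.preimage_isClosed_of_isClosed isClosed_Icc isClosed_Ici)
      inter_subset_left) ⟨t, ht, not_lt.1 hcon⟩)
  have hτb : τ ≤ b := hτ.2.trans hcb
  have hmem : ∀ s ∈ Ico a τ, s ∈ Icc a b := fun s hs => ⟨hs.1, hs.2.le.trans hτb⟩
  have hlt : ∀ s ∈ Ico a τ, dist (u s) (w s) < σ := fun s hs => by
    by_contra h
    exact absurd (hleast ⟨⟨hs.1, hs.2.le.trans hτ.2⟩, not_lt.1 h⟩) (not_le.2 hs.2)
  have key := dist_le_of_trajectories_ODE_of_mem (v := fun _ => v)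
    (s := fun _ => cthickening η (u '' Icc a b)) (f := u) (g := w) (a := a) (b := τ) (K := K)
    (δ := dist (u a) (w a)) (fun _ _ => hK) (hu.mono (Icc_subset_Icc_right hτb))
    (fun s hs => hu' s ⟨hs.1, hs.2.trans_le hτb⟩)
    (fun s hs => self_subset_cthickening _ (mem_image_of_mem u (hmem s hs)))
    (hw.mono (Icc_subset_Icc_right hτ.2)) (fun s hs => hw' s ⟨hs.1, hs.2.trans_le hτ.2⟩)
    (fun s hs => closedBall_subset_cthickening (mem_image_of_mem u (hmem s hs)) η (by
      rw [mem_closedBall, dist_comm]; exact (hlt s hs).le.trans (min_le_right _ _)))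
    le_rfl τ ⟨hτ.1, le_rfl⟩
  have hexp : Real.exp (K * (τ - a)) ≤ Real.exp (K * |b - a|) := by
    gcongr
    exact (by linarith : τ - a ≤ b - a).trans (le_abs_self _)
  have : dist (u a) (w a) * Real.exp (K * (τ - a)) < σ := by
    calc dist (u a) (w a) * Real.exp (K * (τ - a))
        ≤ dist (u a) (w a) * Real.exp (K * |b - a|) := by gcongr
      _ < σ * Real.exp (-(K * |b - a|)) * Real.exp (K * |b - a|) := by gcongr
      _ = σ := by rw [mul_assoc, ← Real.exp_add]; simp
  exact absurd hτσ (not_le.2 (key.trans_lt this))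

/-- The autonomous vector field of the arc-length system, on triples `(x, r, θ)`. -/
noncomputable def arcField (n : ℕ) (f : ℝ → ℝ) (p : ℝ × ℝ × ℝ) : ℝ × ℝ × ℝ :=
  (Real.cos p.2.2, Real.sin p.2.2,
    (((n : ℝ) - 1) / p.2.1 - p.2.1 / 2 * deriv f (p.1 ^ 2 + p.2.1 ^ 2)) * Real.cos p.2.2
      + p.1 / 2 * deriv f (p.1 ^ 2 + p.2.1 ^ 2) * Real.sin p.2.2)

theorem contDiffOn_arcField (n : ℕ) {f : ℝ → ℝ} (hf : ContDiff ℝ 2 f) :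
    ContDiffOn ℝ 1 (arcField n f) {p | 0 < p.2.1} := by
  have hf' : ContDiff ℝ 1 (deriv f) := ((contDiff_succ_iff_deriv (n := 1)).1 hf).2.2
  have h1 : ContDiff ℝ 1 fun p : ℝ × ℝ × ℝ => deriv f (p.1 ^ 2 + p.2.1 ^ 2) :=
    hf'.comp (by fun_prop)
  have h2 : ContDiffOn ℝ 1 (fun p : ℝ × ℝ × ℝ => ((n : ℝ) - 1) / p.2.1) {p | 0 < p.2.1} :=
    contDiffOn_const.div (by fun_prop) fun p hp => ne_of_gt hp
  refine ContDiffOn.prodMk (by fun_prop) (ContDiffOn.prodMk (by fun_prop) ?_)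
  exact ((h2.sub (ContDiff.contDiffOn (by fun_prop))).mul (by fun_prop)).add
    (ContDiff.contDiffOn (by fun_prop))

theorem SolvesSystem.hasDerivAt_prodMk {n : ℕ} {f x r θ : ℝ → ℝ} {s : Set ℝ}
    (h : SolvesSystem n f x r θ s) {t : ℝ} (ht : t ∈ s) :
    HasDerivAt (fun t => (x t, r t, θ t)) (arcField n f (x t, r t, θ t)) t :=
  (h t ht).1.prodMk ((h t ht).2.1.prodMk (h t ht).2.2)

/-- If a solution reaches `x = 0` transversally at height `r > 0`, nearby solutions first reach
`x = 0` at heights bounded below. -/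
theorem exists_exit_height_lower_bound_of_transversal {n : ℕ} {f : ℝ → ℝ} (hf : ContDiff ℝ 2 f)
    {x r θ : ℝ → ℝ} {T : ℝ} (hT : 0 < T) (hsol : SolvesSystem n f x r θ (Icc 0 T))
    (hr : ∀ t ∈ Icc 0 T, 0 < r t) (hxT : x T = 0) (hcos : Real.cos (θ T) < 0) :
    ∃ ε > 0, ∃ δ > 0, ∀ (x' r' θ' : ℝ → ℝ) (T' : ℝ), 0 < T' →
      SolvesSystem n f x' r' θ' (Icc 0 T') → (∀ t ∈ Ioo 0 T', 0 < x' t) →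
      x' 0 = x 0 → θ' 0 = θ 0 → dist (r 0) (r' 0) < ε → δ ≤ r' T' := by
  set U : Set (ℝ × ℝ × ℝ) := {p | 0 < p.2.1} with hU
  have hUo : IsOpen U := isOpen_lt continuous_const (by fun_prop)
  have hUc : Convex ℝ U := by
    intro p hp q hq a b ha hb hab
    have hp' : 0 < p.2.1 := hp
    have hq' : 0 < q.2.1 := hq
    show 0 < a * p.2.1 + b * q.2.1
    rcases ha.eq_or_lt with rfl | ha
    · have : b = 1 := by linarith
      subst this; linarith
    · have := mul_pos ha hp'
      have := mul_nonneg hb hq'.le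
      linarith
  have hv := contDiffOn_arcField n hf
  set u : ℝ → ℝ × ℝ × ℝ := fun t => (x t, r t, θ t) with hu
  have huT : u T ∈ U := hr T ⟨hT.le, le_rfl⟩
  obtain ⟨α, hαT, ε₀, hε₀, hα⟩ := ContDiffAt.exists_forall_mem_closedBall_exists_eq_forall_mem_Ioo_hasDerivAt₀
    (hv.contDiffAt (hUo.mem_nhds huT)) T
  have hαd := hα T ⟨by linarith, by linarith⟩
  have hneg : ∀ᶠ t in 𝓝[>] T, (α t).1 < 0 := by
    have h1 : HasDerivAt (fun t => (α t).1) (Real.cos (θ T)) T := by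
      have := hαd.fst
      rw [hαT] at this
      exact this
    have h2 := eventually_nhdsWithin_sign_eq_of_deriv_neg (f := fun t => (α t).1) (x₀ := T)
      (by rw [h1.deriv]; exact hcos) (by simp [hαT, hu, hxT])
    filter_upwards [h2.filter_mono nhdsWithin_le_nhds, self_mem_nhdsWithin] with t ht htT
    have htT : T < t := htT
    rw [sign_neg (by linarith : T - t < 0)] at ht
    exact sign_eq_neg_one_iff.1 ht
  have hpos : ∀ᶠ t in 𝓝[≥] T, α t ∈ U :=
    (hαd.continuousAt.eventually_mem (hUo.mem_nhds (by rw [hαT]; exact huT))).filter_mono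
      nhdsWithin_le_nhds
  obtain ⟨b, hTb, hb⟩ := (mem_nhdsGE_iff_exists_Ico_subset).1 hpos
  obtain ⟨S, hSneg, hTS, hS⟩ := (hneg.and (Ioo_mem_nhdsGT
    (lt_min hTb (by linarith : T < T + ε₀)))).exists
  have hSb := hS.trans_le (min_le_left _ _)
  have hSε := hS.trans_le (min_le_right _ _)
  set y : ℝ → ℝ × ℝ × ℝ := fun t => if t < T then u t else α t with hy
  have hyu : EqOn y u (Icc 0 T) := fun t ht => by
    rcases ht.2.lt_or_eq with h | rfl
    · simp [hy, h]
    · simp [hy, hαT]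
  have hyα : EqOn y α (Ici T) := fun t ht => by simp [hy, not_lt.2 (mem_Ici.1 ht)]
  have hyU : ∀ t ∈ Icc 0 S, y t ∈ U := fun t ht => by
    rcases le_total t T with h | h
    · rw [hyu ⟨ht.1, h⟩]; exact hr t ⟨ht.1, h⟩
    · rw [hyα h]; exact hb ⟨h, ht.2.trans_lt hSb⟩
  have hyc : ContinuousOn y (Icc 0 S) := by
    rw [← Icc_union_Icc_eq_Icc hT.le hTS.le]
    refine ContinuousOn.union_of_isClosed ?_ ?_ isClosed_Icc isClosed_Icc
    · exact ContinuousOn.congr (fun t ht =>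
        (hsol.hasDerivAt_prodMk ht).continuousAt.continuousWithinAt) hyu
    · exact ContinuousOn.congr (fun t ht => (hα t ⟨by linarith [ht.1], by linarith [ht.2]⟩
        ).continuousAt.continuousWithinAt) (hyα.mono fun t ht => ht.1)
  have hyd : ∀ t ∈ Ico 0 S, HasDerivWithinAt y (arcField n f (y t)) (Ici t) t := fun t ht => by
    rcases lt_or_ge t T with h | h
    · rw [hyu ⟨ht.1, h.le⟩]
      refine HasDerivAt.hasDerivWithinAt
        ((hsol.hasDerivAt_prodMk ⟨ht.1, h.le⟩).congr_of_eventuallyEq ?_)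
      filter_upwards [Iio_mem_nhds h] with s hs
      simp only [hy, if_pos (mem_Iio.1 hs), hu]
    · rw [hyα h]
      exact (hα t ⟨by linarith, by linarith [ht.2]⟩).hasDerivWithinAt.congr
        (fun s hs => hyα (h.trans hs)) (hyα h)
  obtain ⟨t₀, ht₀, hmin⟩ := isCompact_Icc.exists_isMinOn (nonempty_Icc.2 (hT.le.trans hTS.le))
    (hyc.snd.fst)
  have hc : 0 < (y t₀).2.1 := hyU t₀ ht₀
  set ρ := min ((y t₀).2.1 / 2) (-(y S).1) with hρ
  have hρ0 : 0 < ρ := lt_min (by linarith) (by rw [hyα hTS.le]; linarith)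
  obtain ⟨ε, hε, H⟩ := exists_forall_dist_lt_of_dist_initial_lt hUo hUc hv hyc hyd hyU hρ0
  refine ⟨ε, hε, (y t₀).2.1 / 2, by linarith, fun x' r' θ' T' hT' hsol' hx' hx0 hθ0 hr0 => ?_⟩
  have h0 : dist (y 0) (x' 0, r' 0, θ' 0) < ε := by
    rw [hyu ⟨le_rfl, hT.le⟩]
    simp only [hu, Prod.dist_eq, hx0, hθ0, dist_self]
    exact max_lt hε (max_lt hr0 hε)
  have hw : ∀ c ≤ T', ContinuousOn (fun t => (x' t, r' t, θ' t)) (Icc 0 c) := fun c hc t ht =>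
    (hsol'.hasDerivAt_prodMk ⟨ht.1, ht.2.trans hc⟩).continuousAt.continuousWithinAt
  have hw' : ∀ c ≤ T', ∀ t ∈ Ico 0 c, HasDerivWithinAt (fun t => (x' t, r' t, θ' t))
      (arcField n f (x' t, r' t, θ' t)) (Ici t) t := fun c hc t ht =>
    (hsol'.hasDerivAt_prodMk ⟨ht.1, ht.2.le.trans hc⟩).hasDerivWithinAt
  rcases le_or_gt T' S with hTS' | hTS'
  · have hd := H T' hTS' _ (hw T' le_rfl) (hw' T' le_rfl) h0 T' ⟨hT'.le, le_rfl⟩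
    have hd2 : dist (y T').2.1 (r' T') < ρ :=
      lt_of_le_of_lt ((le_max_left _ _).trans (le_max_right _ _)) hd
    have h1 := (abs_lt.1 (Real.dist_eq _ _ ▸ hd2)).2
    have h2 : (y t₀).2.1 ≤ (y T').2.1 := hmin ⟨hT'.le, hTS'⟩
    have h3 := min_le_left ((y t₀).2.1 / 2) (-(y S).1)
    linarith
  · have hd := H S le_rfl _ (hw S hTS'.le) (hw' S hTS'.le) h0 S ⟨by linarith, le_rfl⟩
    have hd2 : dist (y S).1 (x' S) < ρ := lt_of_le_of_lt (le_max_left _ _) hd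
    have h1 := (abs_lt.1 (Real.dist_eq _ _ ▸ hd2)).1
    have h2 := hx' S ⟨by linarith, hTS'⟩
    have h3 := min_le_right ((y t₀).2.1 / 2) (-(y S).1)
    linarith

theorem HasDerivAt.nonpos_of_eventually_pos_left {g : ℝ → ℝ} {d T : ℝ} (hg : HasDerivAt g d T)
    (hT : g T = 0) (hpos : ∀ᶠ t in 𝓝[<] T, 0 < g t) : d ≤ 0 := by
  by_contra! hd
  have h := eventually_nhdsWithin_sign_eq_of_deriv_pos (by rwa [hg.deriv]) hT
  obtain ⟨t, ⟨h1, h2⟩, ht⟩ :=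
    (((h.filter_mono nhdsWithin_le_nhds).and hpos).and self_mem_nhdsWithin).exists
  rw [sign_pos h2, sign_neg (sub_neg.2 ht)] at h1
  exact absurd h1 (by decide)

/-- A solution cannot reach `x = 0` vertically. -/
theorem SolvesSystem.cos_neg_of_exit {n : ℕ} (hn : 2 ≤ n) {M : ℝ} {f : ℝ → ℝ}
    (hf : Continuous (deriv f)) (hlow : ∀ s, 0 ≤ deriv f s) (hup : ∀ s, deriv f s ≤ M)
    {x r θ : ℝ → ℝ} {T : ℝ} (hT : 0 < T) (hsol : SolvesSystem n f x r θ (Icc 0 T))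
    (hx : ∀ t ∈ Ioo 0 T, 0 < x t) (hr : ∀ t ∈ Ioo 0 T, 0 < r t) (hxT : x T = 0) :
    Real.cos (θ T) < 0 := by
  have hM : 0 ≤ M := (hlow 0).trans (hup 0)
  have hn1 : (0 : ℝ) ≤ (n : ℝ) - 1 := by
    have : (2 : ℝ) ≤ n := by exact_mod_cast hn
    linarith
  obtain ⟨hx', hr', hθ'⟩ := hsol T ⟨hT.le, le_rfl⟩
  have hev : ∀ᶠ t in 𝓝[<] T, t ∈ Ioo 0 T := Ioo_mem_nhdsLT hT
  refine lt_of_le_of_ne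
    (hx'.nonpos_of_eventually_pos_left hxT (hev.mono hx)) fun hcos => ?_
  have hrc := hr'.continuousAt
  have hsc : ContinuousAt (fun t => Real.sin (θ t)) T :=
    Real.continuous_sin.continuousAt.comp hθ'.continuousAt
  obtain ⟨K, hK⟩ : ∃ K : ℝ, ∀ᶠ t in 𝓝[<] T,
      (((n : ℝ) - 1) / r t - r t / 2 * deriv f (x t ^ 2 + r t ^ 2)) * Real.sin (θ t) ≤ K := by
    have hrT : 0 ≤ r T := ge_of_tendsto (hrc.tendsto.mono_left nhdsWithin_le_nhds)
      (hev.mono fun t ht => (hr t ht).le)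
    rcases hrT.eq_or_lt with h0 | h0
    · have hsin : Real.sin (θ T) < 0 := by
        have h1 := hr'.nonpos_of_eventually_pos_left h0.symm (hev.mono hr)
        have h2 := Real.sin_sq_add_cos_sq (θ T)
        refine lt_of_le_of_ne h1 fun h => ?_
        rw [h, hcos] at h2
        norm_num at h2
      refine ⟨M, ?_⟩
      filter_upwards [hev, (hsc.eventually_lt_const hsin).filter_mono nhdsWithin_le_nhds,
        (hrc.eventually_lt_const (h0 ▸ one_pos : r T < 1)).filter_mono nhdsWithin_le_nhds]
        with t ht h1 h2
      have h3 := hr t ht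
      have h4 : 0 ≤ ((n : ℝ) - 1) / r t := by positivity
      have h5 := Real.neg_one_le_sin (θ t)
      have h6 := hup (x t ^ 2 + r t ^ 2)
      have h7 := hlow (x t ^ 2 + r t ^ 2)
      set F := deriv f (x t ^ 2 + r t ^ 2)
      have h8 : 0 ≤ r t / 2 * F := by positivity
      have h9 : r t / 2 * F ≤ M := by nlinarith
      nlinarith
    · have hc : ContinuousAt (fun t => (((n : ℝ) - 1) / r t
          - r t / 2 * deriv f (x t ^ 2 + r t ^ 2)) * Real.sin (θ t)) T :=
        ((continuousAt_const.div hrc h0.ne').sub ((hrc.div_const 2).mul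
          (hf.continuousAt.comp ((hx'.continuousAt.pow 2).add (hrc.pow 2))))).mul hsc
      exact ⟨_, (hc.eventually_lt_const (lt_add_one _)).filter_mono nhdsWithin_le_nhds
        |>.mono fun _ h => h.le⟩
  obtain ⟨a, haT, ha⟩ := (mem_nhdsLT_iff_exists_Ioo_subset).1 (hK.and hev)
  have haT : a < T := haT
  obtain ⟨b, hab, hbT⟩ := exists_between haT
  set C := 1 + 2 * |K| + M with hC
  have hmono : MonotoneOn (fun t => (x t ^ 2 + Real.cos (θ t) ^ 2) * Real.exp (C * t))
      (Icc b T) := by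
    have hb0 := (ha ⟨hab, hbT⟩).2.1
    have hd : ∀ t ∈ Icc b T,
        HasDerivAt (fun t => (x t ^ 2 + Real.cos (θ t) ^ 2) * Real.exp (C * t)) _ t :=
      fun t ht => ((((hsol t ⟨by linarith [ht.1], ht.2⟩).1).pow 2).add
        ((hsol t ⟨by linarith [ht.1], ht.2⟩).2.2.cos.pow 2)).mul
        (((hasDerivAt_id t).const_mul C).exp)
    refine monotoneOn_of_hasDerivWithinAt_nonneg (convex_Icc b T)
      (fun t ht => (hd t ht).continuousAt.continuousWithinAt)
      (fun t ht => (hd t (interior_subset ht)).hasDerivWithinAt) fun t ht => ?_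
    rw [interior_Icc] at ht
    have h1 : _ ≤ K := (ha ⟨hab.trans ht.1, ht.2⟩).1
    have h1 := h1.trans (le_abs_self K)
    have h6 := hup (x t ^ 2 + r t ^ 2)
    have h7 := hlow (x t ^ 2 + r t ^ 2)
    have h10 := Real.sin_sq_le_one (θ t)
    simp only [id, Nat.cast_ofNat, Nat.add_one_sub_one, pow_one, mul_one, Pi.add_apply, Pi.pow_apply]
    set F := deriv f (x t ^ 2 + r t ^ 2)
    set A := ((n : ℝ) - 1) / r t - r t / 2 * F
    set c := Real.cos (θ t)
    set s := Real.sin (θ t)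
    have h2 : A * s * c ^ 2 ≤ |K| * c ^ 2 := mul_le_mul_of_nonneg_right h1 (sq_nonneg c)
    have h11 : 0 ≤ F * s ^ 2 := by positivity
    have h12 : F * s ^ 2 ≤ M := by nlinarith
    have h3 : 2 * (F * s ^ 2) * (x t * c) ≤ M * (x t ^ 2 + c ^ 2) * 2 := by
      nlinarith [sq_nonneg (x t - c), sq_nonneg (x t), sq_nonneg c,
        mul_nonneg h11 (sq_nonneg (x t - c)),
        mul_nonneg (sub_nonneg.2 h12) (add_nonneg (sq_nonneg (x t)) (sq_nonneg c)),
        mul_nonneg hM (add_nonneg (sq_nonneg (x t)) (sq_nonneg c))]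
    have h4 : 0 ≤ |K| * x t ^ 2 := by positivity
    have h5 : 0 ≤ 2 * x t * c + 2 * c * (-s * (A * c + x t / 2 * F * s))
        + (x t ^ 2 + c ^ 2) * C := by
      rw [hC]
      nlinarith [sq_nonneg (x t + c)]
    have h13 := mul_nonneg h5 (Real.exp_pos (C * t)).le
    calc (0 : ℝ) ≤ _ := h13
      _ = _ := by ring
  have hle := hmono (left_mem_Icc.2 hbT.le) (right_mem_Icc.2 hbT.le) hbT.le
  simp only [hxT, hcos] at hle
  have hxb := hx b (ha ⟨hab, hbT⟩).2
  have : 0 < (x b ^ 2 + Real.cos (θ b) ^ 2) * Real.exp (C * b) := by positivity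
  norm_num at hle
  linarith

/-- A solution meeting `x = 0` does so at positive height. -/
theorem SolvesSystem.height_pos_of_exit {n : ℕ} (hn : 2 ≤ n) {M : ℝ} {f : ℝ → ℝ}
    (hf : Continuous (deriv f)) (hlow : ∀ s, 0 ≤ deriv f s) (hup : ∀ s, deriv f s ≤ M)
    {x r θ : ℝ → ℝ} {T : ℝ} (hT : 0 < T) (hsol : SolvesSystem n f x r θ (Icc 0 T))
    (hx : ∀ t ∈ Ioo 0 T, 0 < x t) (hr : ∀ t ∈ Ioo 0 T, 0 < r t) (hxT : x T = 0) :
    0 < r T := by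
  have hcos := hsol.cos_neg_of_exit hn hf hlow hup hT hx hr hxT
  have hM : 0 ≤ M := (hlow 0).trans (hup 0)
  have hn1 : (1 : ℝ) ≤ (n : ℝ) - 1 := by
    have : (2 : ℝ) ≤ n := by exact_mod_cast hn
    linarith
  obtain ⟨hx', hr', hθ'⟩ := hsol T ⟨hT.le, le_rfl⟩
  have hev : ∀ᶠ t in 𝓝[<] T, t ∈ Ioo 0 T := Ioo_mem_nhdsLT hT
  have hrlim := hr'.continuousAt.tendsto.mono_left (nhdsWithin_le_nhds (s := Iio T))
  refine lt_of_le_of_ne (ge_of_tendsto hrlim (hev.mono fun t ht => (hr t ht).le)) fun h0 => ?_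
  rw [← h0] at hrlim
  set c := -Real.cos (θ T) / 2 with hc
  have hc0 : 0 < c := by linarith
  have hcev : ∀ᶠ t in 𝓝[<] T, Real.cos (θ t) < -c :=
    ((Real.continuous_cos.continuousAt.comp hθ'.continuousAt).eventually_lt_const
      (by simp only [Function.comp]; linarith)).filter_mono nhdsWithin_le_nhds
  have hr1 : ∀ᶠ t in 𝓝[<] T, r t < 1 :=
    (hr'.continuousAt.eventually_lt_const (h0 ▸ one_pos)).filter_mono nhdsWithin_le_nhds
  have hx1 : ∀ᶠ t in 𝓝[<] T, x t < 1 :=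
    (hx'.continuousAt.eventually_lt_const (hxT ▸ one_pos)).filter_mono nhdsWithin_le_nhds
  obtain ⟨a, haT, ha⟩ := (mem_nhdsLT_iff_exists_Ioo_subset).1
    (hev.and (hcev.and (hr1.and hx1)))
  have hanti : AntitoneOn (fun t => θ t - c * Real.log (r t) - M * t) (Ioo a T) := by
    have hd : ∀ t ∈ Ioo a T, HasDerivAt (fun t => θ t - c * Real.log (r t) - M * t) _ t :=
      fun t ht =>
        have ht0 := (ha ht).1
        have hs := hsol t ⟨ht0.1.le, ht0.2.le⟩
        (hs.2.2.sub ((hs.2.1.log (hr t ht0).ne').const_mul c)).sub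
          ((hasDerivAt_id t).const_mul M)
    refine antitoneOn_of_hasDerivWithinAt_nonpos (convex_Ioo a T)
      (fun t ht => (hd t ht).continuousAt.continuousWithinAt)
      (fun t ht => (hd t (interior_subset ht)).hasDerivWithinAt) fun t ht => ?_
    rw [interior_Ioo] at ht
    obtain ⟨ht0, h1, h2, h3⟩ := ha ht
    have h1 : Real.cos (θ t) < -c := h1
    have h2 : r t < 1 := h2
    have h3 : x t < 1 := h3
    have hrt := hr t ht0
    have hxt := hx t ht0
    have h6 := hup (x t ^ 2 + r t ^ 2)
    have h7 := hlow (x t ^ 2 + r t ^ 2)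
    set F := deriv f (x t ^ 2 + r t ^ 2)
    have h4 : ((n : ℝ) - 1) / r t * Real.cos (θ t) ≤ -(c / r t) := by
      have e1 : 1 / r t ≤ ((n : ℝ) - 1) / r t := by gcongr
      have e2 : 0 < 1 / r t := by positivity
      have e3 : c / r t = 1 / r t * c := by ring
      rw [e3]
      nlinarith
    have h5 : -(c * (Real.sin (θ t) / r t)) ≤ c / r t := by
      have e4 : c / r t + c * (Real.sin (θ t) / r t) = c / r t * (1 + Real.sin (θ t)) := by ring
      have e5 : 0 ≤ c / r t * (1 + Real.sin (θ t)) :=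
        mul_nonneg (by positivity) (by linarith [Real.neg_one_le_sin (θ t)])
      linarith
    have h8 : -(r t / 2 * F * Real.cos (θ t)) ≤ M / 2 := by
      have e6 : 0 ≤ r t / 2 * F := by positivity
      have e7 : r t / 2 * F ≤ M / 2 := by nlinarith
      nlinarith [Real.neg_one_le_cos (θ t)]
    have h9 : x t / 2 * F * Real.sin (θ t) ≤ M / 2 := by
      have e6 : 0 ≤ x t / 2 * F := by positivity
      have e7 : x t / 2 * F ≤ M / 2 := by nlinarith
      nlinarith [Real.sin_le_one (θ t)]
    linarith
  have hlog : Tendsto (fun t => Real.log (r t)) (𝓝[<] T) atBot :=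
    Real.tendsto_log_nhdsGT_zero.comp
      (tendsto_nhdsWithin_iff.2 ⟨hrlim, hev.mono fun t ht => hr t ht⟩)
  have hlim : Tendsto (fun t => θ t - M * t + c * -Real.log (r t)) (𝓝[<] T) atTop :=
    ((hθ'.continuousAt.sub (by fun_prop : ContinuousAt (fun t => M * t) T)).tendsto.mono_left
      nhdsWithin_le_nhds).add_atTop ((tendsto_neg_atBot_atTop.comp hlog).const_mul_atTop hc0)
  obtain ⟨b, hab, hbT⟩ := exists_between (mem_Iio.1 haT)
  obtain ⟨t, ht, hbt⟩ := ((hlim.eventually_gt_atTop (θ b - c * Real.log (r b) - M * b)).and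
    (Ioo_mem_nhdsLT hbT)).exists
  have := hanti ⟨hab, hbT⟩ ⟨hab.trans hbt.1, hbt.2⟩ hbt.1.le
  simp only at this
  linarith

theorem pos_on_Ioo_of_ne_zero {g : ℝ → ℝ} {T t₀ : ℝ} (hg : ContinuousOn g (Ioo 0 T))
    (hne : ∀ t ∈ Ioo 0 T, g t ≠ 0) (ht₀ : t₀ ∈ Ioo 0 T) (hpos : 0 < g t₀) :
    ∀ t ∈ Ioo 0 T, 0 < g t := by
  intro t ht
  by_contra! h
  obtain ⟨s, hs, hs0⟩ := isPreconnected_Ioo.intermediate_value ht ht₀ hg ⟨h, hpos.le⟩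
  exact hne s hs hs0

/-- If for every `R ∈ [R*, R*+1]` the solution of (1.5)–(1.6) has a finite first exit
time `T R` with `x_R(T R) = 0`, then `inf { r_R(T R) : R ∈ [R*, R*+1] } > 0`. -/
theorem inf_exit_height_pos
    (n : ℕ) (hn : 2 ≤ n) (m M : ℝ) (hm : 0 < m) (hmM : m ≤ M)
    (f : ℝ → ℝ) (hf : ContDiff ℝ 2 f)
    (hconv : ∀ s : ℝ, 0 ≤ deriv (deriv f) s)
    (hlow : ∀ s : ℝ, m ≤ deriv f s) (hup : ∀ s : ℝ, deriv f s ≤ M)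
    (Rstar : ℝ) (hRstar : 0 < Rstar)
    (X Rr Θ : ℝ → ℝ → ℝ) (T : ℝ → ℝ)
    (hsol : ∀ R ∈ Set.Icc Rstar (Rstar + 1),
      X R 0 = 0 ∧ Rr R 0 = R ∧ Θ R 0 = 0 ∧ 0 < T R ∧
      SolvesSystem n f (X R) (Rr R) (Θ R) (Set.Icc 0 (T R)) ∧
      NoExit (X R) (Rr R) (Θ R) (Set.Ioo 0 (T R)) ∧
      X R (T R) = 0) :
    ∃ δ : ℝ, 0 < δ ∧ ∀ R ∈ Set.Icc Rstar (Rstar + 1), δ ≤ Rr R (T R) := by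
  have hf' : Continuous (deriv f) := hf.continuous_deriv (by norm_num)
  have hlow' : ∀ s, 0 ≤ deriv f s := fun s => hm.le.trans (hlow s)
  have hX : ∀ R ∈ Icc Rstar (Rstar + 1), ∀ t ∈ Ioo 0 (T R), 0 < X R t := by
    intro R hR
    obtain ⟨hx0, -, hθ0, hT, hs, hne, -⟩ := hsol R hR
    have hd := (hs 0 ⟨le_rfl, hT.le⟩).1
    rw [hθ0, Real.cos_zero] at hd
    have h := eventually_nhdsWithin_sign_eq_of_deriv_pos (by rw [hd.deriv]; exact one_pos) hx0
    obtain ⟨t, ht, htT⟩ :=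
      ((h.filter_mono (nhdsWithin_le_nhds (s := Ioi 0))).and (Ioo_mem_nhdsGT hT)).exists
    rw [sub_zero, sign_pos htT.1, sign_eq_one_iff] at ht
    exact pos_on_Ioo_of_ne_zero
      (fun s hs' => (hs s (Ioo_subset_Icc_self hs')).1.continuousAt.continuousWithinAt)
      (fun s hs' => (hne s hs').2.2.1) htT ht
  have hRr : ∀ R ∈ Icc Rstar (Rstar + 1), ∀ t ∈ Icc 0 (T R), 0 < Rr R t := by
    intro R hR
    obtain ⟨-, hr0, -, hT, hs, hne, hxT⟩ := hsol R hR
    have hr0 : 0 < Rr R 0 := by rw [hr0]; exact hRstar.trans_le hR.1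
    have hc : ContinuousAt (Rr R) 0 := (hs 0 ⟨le_rfl, hT.le⟩).2.1.continuousAt
    obtain ⟨t, ht, htT⟩ := (((hc.eventually_const_lt hr0).filter_mono
      (nhdsWithin_le_nhds (s := Ioi 0))).and (Ioo_mem_nhdsGT hT)).exists
    have hpos := pos_on_Ioo_of_ne_zero
      (fun s hs' => (hs s (Ioo_subset_Icc_self hs')).2.1.continuousAt.continuousWithinAt)
      (fun s hs' => (hne s hs').2.2.2) htT ht
    intro s hs'
    rcases hs'.1.eq_or_lt with rfl | h1
    · exact hr0
    rcases hs'.2.eq_or_lt with rfl | h2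
    · exact hs.height_pos_of_exit hn hf' hlow' hup hT (hX R hR) hpos hxT
    · exact hpos s ⟨h1, h2⟩
  refine isCompact_Icc.induction_on
    (p := fun s => ∃ δ : ℝ, 0 < δ ∧ ∀ R ∈ s ∩ Icc Rstar (Rstar + 1), δ ≤ Rr R (T R))
    ⟨1, one_pos, by simp⟩ ?_ ?_ ?_ |>.imp fun δ hδ => ⟨hδ.1, fun R hR => hδ.2 R ⟨hR, hR⟩⟩
  · rintro s t hst ⟨δ, hδ, h⟩
    exact ⟨δ, hδ, fun R hR => h R ⟨hst hR.1, hR.2⟩⟩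
  · rintro s t ⟨δ, hδ, h⟩ ⟨δ', hδ', h'⟩
    refine ⟨min δ δ', lt_min hδ hδ', ?_⟩
    rintro R ⟨hR | hR, hR'⟩
    · exact (min_le_left _ _).trans (h R ⟨hR, hR'⟩)
    · exact (min_le_right _ _).trans (h' R ⟨hR, hR'⟩)
  · intro R hR
    obtain ⟨hx0, hr0, hθ0, hT, hs, hne, hxT⟩ := hsol R hR
    have hcos := hs.cos_neg_of_exit hn hf' hlow' hup hT (hX R hR)
      (fun t ht => hRr R hR t (Ioo_subset_Icc_self ht)) hxT
    obtain ⟨ε, hε, δ, hδ, H⟩ :=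
      exists_exit_height_lower_bound_of_transversal hf hT hs (hRr R hR) hxT hcos
    refine ⟨ball R ε, mem_nhdsWithin_of_mem_nhds (ball_mem_nhds R hε), δ, hδ, ?_⟩
    rintro R' ⟨hRε, hR'⟩
    obtain ⟨hx0', hr0', hθ0', hT', hs', -, -⟩ := hsol R' hR'
    exact H _ _ _ _ hT' hs' (hX R' hR') (hx0'.trans hx0.symm) (hθ0'.trans hθ0.symm)
      (by rw [hr0, hr0', dist_comm]; exact hRε)
end
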